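/- arXiv:math/0502211 — 2 statements merged into one kernel-verified Lean document; each statement's English description precedes it below -/
import Mathlib

section
/- Let D be a separable, unital, strongly self-absorbing, K₁-injective C*-algebra, let A be a separable D-stable C*-algebra, and let B ⊆ A be a hereditary C*-subalgebra. Then B is D-stable. -/
open scoped MultiplierAlgebra TensorProduct
open Filter Topology

noncomputable section

universe u v w x

/-- Approximate unitary equivalence of two maps `φ ψ : A → B`, witnessed by a sequence of
unitaries in the multiplier algebra `𝓜(ℂ, B)` (in which `B` embeds canonically). -/
def ApproxUnitaryEquiv {A : Type u} {B : Type v} [NonUnitalCStarAlgebra B]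
    (φ ψ : A → B) : Prop :=
  ∃ v : ℕ → 𝓜(ℂ, B), (∀ n, v n ∈ unitary 𝓜(ℂ, B)) ∧
    ∀ a : A, Tendsto
      (fun n => ‖star (v n) * (φ a : 𝓜(ℂ, B)) * v n - (ψ a : 𝓜(ℂ, B))‖)
      atTop (𝓝 (0 : ℝ))

/-- Data exhibiting `T` as a C*-tensor product of `A` and `B`: a bilinear, multiplicative,
star-preserving, cross-normed map `A × B → T` with dense span. -/
structure CStarTensor (A : Type u) (B : Type v) (T : Type w) [NonUnitalCStarAlgebra A]
    [NonUnitalCStarAlgebra B] [NonUnitalCStarAlgebra T] where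
  tmul : A → B → T
  add_left : ∀ a a' b, tmul (a + a') b = tmul a b + tmul a' b
  add_right : ∀ a b b', tmul a (b + b') = tmul a b + tmul a b'
  smul_left : ∀ (c : ℂ) a b, tmul (c • a) b = c • tmul a b
  smul_right : ∀ (c : ℂ) a b, tmul a (c • b) = c • tmul a b
  mul_tmul : ∀ a a' b b', tmul a b * tmul a' b' = tmul (a * a') (b * b')
  star_tmul : ∀ a b, star (tmul a b) = tmul (star a) (star b)
  norm_tmul : ∀ a b, ‖tmul a b‖ = ‖a‖ * ‖b‖
  dense_span : Dense ((Submodule.span ℂ {t : T | ∃ a b, tmul a b = t} : Submodule ℂ T) : Set T)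

/-- Data exhibiting `T` as *the minimal (spatial) tensor product* of `A` and `B`: a C*-tensor
product which is dominated by every other C*-tensor product of `A` and `B` (i.e., it carries
the smallest C*-norm). -/
structure MinTensor (A : Type u) (B : Type v) (T : Type w) [NonUnitalCStarAlgebra A]
    [NonUnitalCStarAlgebra B] [NonUnitalCStarAlgebra T] extends CStarTensor A B T where
  minimal : ∀ (T' : Type (max u v)) [NonUnitalCStarAlgebra T'] (h : CStarTensor A B T'),
    ∃ π : T' →⋆ₙₐ[ℂ] T, ∀ a b, π (h.tmul a b) = tmul a b

/-- The first-factor unital embedding `d ↦ d ⊗ 1`. -/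
def MinTensor.fst {D : Type u} {E : Type v} {T : Type w} [CStarAlgebra D] [CStarAlgebra E]
    [CStarAlgebra T] (h : MinTensor D E T) : D → T := fun d => h.tmul d 1

/-- The second-factor unital embedding `d ↦ 1 ⊗ d`. -/
def MinTensor.snd {D : Type u} {E : Type v} {T : Type w} [CStarAlgebra D] [CStarAlgebra E]
    [CStarAlgebra T] (h : MinTensor D E T) : E → T := fun d => h.tmul 1 d

/-- A unital C*-algebra `D` has *approximately inner half flip* (with respect to a
realization `T` of the minimal tensor product `D ⊗ D`) if the two factor embeddings
`id_D ⊗ 1_D` and `1_D ⊗ id_D` of `D` into `D ⊗ D` are approximately unitarily equivalent. -/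
def HasApproxInnerHalfFlip {D : Type u} {T : Type w} [CStarAlgebra D] [CStarAlgebra T]
    (h : MinTensor D D T) : Prop :=
  ApproxUnitaryEquiv h.fst h.snd

/-- A unital C*-algebra `D` has *approximately inner flip* (with respect to a realization
`T` of `D ⊗ D`) if the flip automorphism `σ_D : a ⊗ b ↦ b ⊗ a` of `D ⊗ D` is approximately
unitarily equivalent to the identity map. -/
def HasApproxInnerFlip {D : Type u} {T : Type w} [CStarAlgebra D] [CStarAlgebra T]
    (h : MinTensor D D T) : Prop :=
  ∃ σ : T ≃⋆ₐ[ℂ] T, (∀ a b, σ (h.tmul a b) = h.tmul b a) ∧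
    ApproxUnitaryEquiv (⇑σ) (id : T → T)

/-- A unital C*-algebra `D ≇ ℂ` is *strongly self-absorbing* (with respect to a realization
`T` of the minimal tensor product `D ⊗ D`) if there is an isomorphism `φ : D → D ⊗ D` which
is approximately unitarily equivalent to `id_D ⊗ 1_D`. -/
def IsStronglySelfAbsorbing {D : Type u} {T : Type w} [CStarAlgebra D] [CStarAlgebra T]
    (h : MinTensor D D T) : Prop :=
  IsEmpty (D ≃⋆ₐ[ℂ] ℂ) ∧ ∃ φ : D ≃⋆ₐ[ℂ] T, ApproxUnitaryEquiv (⇑φ) h.fst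

/-- The image of `u` under the upper-left-corner stabilization `u ↦ diag(u, 1, …, 1)`
into `M_{n+1}(A)`. -/
def stabUnitary {A : Type u} [CStarAlgebra A] (n : ℕ) (u : A) :
    Matrix (Fin (n + 1)) (Fin (n + 1)) A :=
  Matrix.diagonal (fun i => if i = 0 then u else 1)

/-- A unitary `u` represents `0` in `K₁(A)`: some matrix stabilization `diag(u, 1, …, 1)`
is connected to the identity through the unitary group of a matrix algebra over `A`. -/
def RepresentsZeroInK1 {A : Type u} [CStarAlgebra A] (u : A) : Prop :=
  ∃ n : ℕ, ∃ h : stabUnitary n u ∈ unitary (Matrix (Fin (n + 1)) (Fin (n + 1)) A),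
    Joined (⟨stabUnitary n u, h⟩ : ↥(unitary (Matrix (Fin (n + 1)) (Fin (n + 1)) A))) 1

/-- A unital C*-algebra is `K₁`-injective if the canonical map `U(A)/U₀(A) → K₁(A)` is
injective, i.e. every unitary representing `0` in `K₁(A)` lies in the connected component
of the unit of `U(A)`. -/
def K1Injective (A : Type u) [CStarAlgebra A] : Prop :=
  ∀ u : ↥(unitary A), RepresentsZeroInK1 (u : A) → Joined u 1

/-- Positivity in a C*-algebra: `x ≥ 0` iff it is of the form `c* c`. -/
def CStarNonneg {A : Type u} [NonUnitalCStarAlgebra A] (x : A) : Prop := ∃ c, x = star c * c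

section

open scoped CStarAlgebra

section Limits

/-- Approximation on finite sets can be organised into a single filter. -/
lemma exists_filter_tendsto_zero {X : Type*} {Y : Type*} (p : X → Y → ℝ)
    (h0 : ∀ x y, 0 ≤ p x y)
    (h : ∀ S : Finset X, ∀ ε > 0, ∃ y, ∀ x ∈ S, p x y < ε) :
    ∃ l : Filter Y, l.NeBot ∧ ∀ x, Tendsto (p x) l (𝓝 0) := by
  classical
  choose f hf using fun (S : Finset X) (n : ℕ) =>
    h S (1 / ((n : ℝ) + 1)) (by positivity)
  refine ⟨map (fun q : Finset X × ℕ => f q.1 q.2) atTop, inferInstance, fun x => ?_⟩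
  rw [tendsto_map'_iff]
  have h1 : Tendsto (fun q : Finset X × ℕ => 1 / ((q.2 : ℝ) + 1)) atTop (𝓝 0) := by
    refine (tendsto_one_div_add_atTop_nhds_zero_nat (𝕜 := ℝ)).comp ?_
    rw [← prod_atTop_atTop_eq]
    exact tendsto_snd
  refine squeeze_zero' (Eventually.of_forall fun q => h0 _ _) ?_ h1
  filter_upwards [eventually_ge_atTop (({x} : Finset X), 0)] with q hq
  exact (hf q.1 q.2 x (hq.1 (by simp))).le

variable {X : Type*} {Y : Type*} [NormedAddCommGroup X] [NormedSpace ℂ X]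
  [NormedAddCommGroup Y] [NormedSpace ℂ Y]

lemma forall_of_dense_span {S : Set X} (hS : Dense ((Submodule.span ℂ S : Submodule ℂ X) : Set X))
    (p : X → Prop) (hmem : ∀ x ∈ S, p x) (hzero : p 0)
    (hadd : ∀ x y, p x → p y → p (x + y)) (hsmul : ∀ (c : ℂ) x, p x → p (c • x))
    (hclos : ∀ x, (∀ ε > 0, ∃ y, p y ∧ ‖x - y‖ < ε) → p x) (x : X) : p x := by
  refine hclos x fun ε hε => ?_
  obtain ⟨y, hy, hxy⟩ := Metric.mem_closure_iff.1 (hS x) ε hε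
  refine ⟨y, ?_, by rwa [← dist_eq_norm]⟩
  clear hxy
  induction hy using Submodule.span_induction with
  | mem x hx => exact hmem x hx
  | zero => exact hzero
  | add x y _ _ hx hy => exact hadd x y hx hy
  | smul c x _ hx => exact hsmul c x hx

lemma tendsto_zero_of_dense_span {I : Type*} {l : Filter I} {S : Set X}
    (hS : Dense ((Submodule.span ℂ S : Submodule ℂ X) : Set X)) (T : I → X →ₗ[ℂ] Y) (K : ℝ)
    (hK : ∀ᶠ i in l, ∀ x, ‖T i x‖ ≤ K * ‖x‖)
    (hT : ∀ x ∈ S, Tendsto (fun i => T i x) l (𝓝 0)) (x : X) :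
    Tendsto (fun i => T i x) l (𝓝 0) := by
  refine forall_of_dense_span hS (fun x => Tendsto (fun i => T i x) l (𝓝 0)) hT (by simp [tendsto_const_nhds])
    (fun x y hx hy => by simpa using hx.add hy) (fun c x hx => by simpa using hx.const_smul c)
    (fun x hx => ?_) x
  rw [Metric.tendsto_nhds]
  intro ε hε
  have hK0 : 0 < |K| + 1 := by positivity
  obtain ⟨y, hy, hxy⟩ := hx (ε / 2 / (|K| + 1)) (by positivity)
  filter_upwards [hK, Metric.tendsto_nhds.1 hy (ε / 2) (by positivity)] with i hi hyi
  rw [dist_zero_right] at hyi ⊢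
  have h1 : T i x = T i (x - y) + T i y := by simp
  have h2 : ‖T i (x - y)‖ ≤ (|K| + 1) * ‖x - y‖ :=
    (hi _).trans (by gcongr; linarith [le_abs_self K])
  have h3 : (|K| + 1) * ‖x - y‖ < ε / 2 := by
    rwa [lt_div_iff₀' hK0] at hxy
  calc ‖T i x‖ ≤ ‖T i (x - y)‖ + ‖T i y‖ := by rw [h1]; exact norm_add_le _ _
    _ < ε := by linarith

lemma exists_limit_of_dense_span [CompleteSpace Y] {I : Type*} {l : Filter I} [l.NeBot] {S : Set X}
    (hS : Dense ((Submodule.span ℂ S : Submodule ℂ X) : Set X)) (T : I → X →ₗ[ℂ] Y) (K : ℝ)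
    (hK : ∀ᶠ i in l, ∀ x, ‖T i x‖ ≤ K * ‖x‖)
    (hT : ∀ x ∈ S, ∃ y, Tendsto (fun i => T i x) l (𝓝 y)) :
    ∃ T' : X →L[ℂ] Y, ∀ x, Tendsto (fun i => T i x) l (𝓝 (T' x)) := by
  have key : ∀ x, ∃ y, Tendsto (fun i => T i x) l (𝓝 y) := by
    refine forall_of_dense_span hS (fun x => ∃ y, Tendsto (fun i => T i x) l (𝓝 y)) hT
      ⟨0, by simp⟩
      (fun x y ⟨x', hx⟩ ⟨y', hy⟩ => ⟨x' + y', by simpa using hx.add hy⟩)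
      (fun c x ⟨x', hx⟩ => ⟨c • x', by simpa using hx.const_smul c⟩)
      (fun x hx => ?_)
    rw [← cauchy_map_iff_exists_tendsto, Metric.cauchy_iff]
    refine ⟨inferInstance, fun ε hε => ?_⟩
    have hK0 : 0 < |K| + 1 := by positivity
    obtain ⟨y, ⟨y', hy⟩, hxy⟩ := hx (ε / 4 / (|K| + 1)) (by positivity)
    have h3 : (|K| + 1) * ‖x - y‖ < ε / 4 := by
      rwa [lt_div_iff₀' hK0] at hxy
    have hev : ∀ᶠ i in l, dist (T i x) y' < ε / 2 := by
      filter_upwards [hK, Metric.tendsto_nhds.1 hy (ε / 4) (by positivity)] with i hi hyi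
      rw [dist_eq_norm] at hyi ⊢
      have h1 : T i x - y' = T i (x - y) + (T i y - y') := by simp
      have h2 : ‖T i (x - y)‖ ≤ (|K| + 1) * ‖x - y‖ :=
        (hi _).trans (by gcongr; linarith [le_abs_self K])
      calc ‖T i x - y'‖ ≤ ‖T i (x - y)‖ + ‖T i y - y'‖ := by rw [h1]; exact norm_add_le _ _
        _ < ε / 2 := by linarith
    refine ⟨Metric.ball y' (ε / 2), hev, fun a ha b hb => ?_⟩
    calc dist a b ≤ dist a y' + dist b y' := dist_triangle_right _ _ _
      _ < ε := by rw [Metric.mem_ball] at ha hb; linarith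
  choose f hf using key
  let F : X →ₗ[ℂ] Y :=
    { toFun := f
      map_add' := fun x y => tendsto_nhds_unique (hf (x + y)) (by simpa using (hf x).add (hf y))
      map_smul' := fun c x => tendsto_nhds_unique (hf (c • x))
        (by simpa using (hf x).const_smul c) }
  refine ⟨F.mkContinuous K fun x => ?_, hf⟩
  exact le_of_tendsto (hf x).norm (hK.mono fun i hi => hi x)

end Limits

section Tensor

variable {A : Type*} {B : Type*} {T : Type*} [NonUnitalCStarAlgebra A]
    [NonUnitalCStarAlgebra B] [NonUnitalCStarAlgebra T]

/-- The tensor map as a bounded bilinear map. -/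
def CStarTensor.bilin (h : CStarTensor A B T) : A →L[ℂ] B →L[ℂ] T :=
  LinearMap.mkContinuous₂ (LinearMap.mk₂ ℂ h.tmul h.add_left h.smul_left h.add_right h.smul_right)
    1 (fun a b => by simp [h.norm_tmul])

@[simp] lemma CStarTensor.bilin_apply (h : CStarTensor A B T) (a : A) (b : B) :
    h.bilin a b = h.tmul a b := rfl

lemma CStarTensor.continuous_tmul (h : CStarTensor A B T) :
    Continuous (fun p : A × B => h.tmul p.1 p.2) :=
  h.bilin.continuous₂

/-- The range of the tensor map spans a separable space if the factors are separable. -/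
lemma CStarTensor.separableSpace (h : CStarTensor A B T) [TopologicalSpace.SeparableSpace A]
    [TopologicalSpace.SeparableSpace B] : TopologicalSpace.SeparableSpace T := by
  have h1 : {t : T | ∃ a b, h.tmul a b = t} = Set.range (fun p : A × B => h.tmul p.1 p.2) := by
    ext t; simp
  have h2 : TopologicalSpace.IsSeparable {t : T | ∃ a b, h.tmul a b = t} := by
    rw [h1]; exact TopologicalSpace.isSeparable_range h.continuous_tmul
  have h3 := (h2.span (R := ℂ)).closure
  rw [h.dense_span.closure_eq] at h3
  exact TopologicalSpace.isSeparable_univ_iff.1 h3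

end Tensor

section Intertwining

/-- A limit of isometric star homomorphisms along a filter is an isometric star homomorphism. -/
lemma exists_starHom_limit {B C I : Type*} [NonUnitalCStarAlgebra B] [NonUnitalCStarAlgebra C]
    {l : Filter I} [l.NeBot] {S : Set B}
    (hS : Dense ((Submodule.span ℂ S : Submodule ℂ B) : Set B)) (T : I → B →⋆ₙₐ[ℂ] C)
    (hiso : ∀ i b, ‖T i b‖ = ‖b‖)
    (hT : ∀ x ∈ S, ∃ y, Tendsto (fun i => T i x) l (𝓝 y)) :
    ∃ T' : B →⋆ₙₐ[ℂ] C, (∀ b, Tendsto (fun i => T i b) l (𝓝 (T' b))) ∧ ∀ b, ‖T' b‖ = ‖b‖ := by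
  obtain ⟨F, hF⟩ := exists_limit_of_dense_span (l := l) hS
    (fun i => { toFun := T i, map_add' := map_add (T i), map_smul' := map_smul (T i) }) 1
    (Eventually.of_forall fun i b => (hiso i b).le.trans (one_mul ‖b‖).ge) hT
  replace hF : ∀ b, Tendsto (fun i => T i b) l (𝓝 (F b)) := hF
  refine ⟨{ toFun := F
            map_smul' := fun c b => by simp
            map_zero' := by simp
            map_add' := fun a b => by simp
            map_mul' := fun a b => tendsto_nhds_unique (hF (a * b))
              (by simpa using (hF a).mul (hF b))
            map_star' := fun a => tendsto_nhds_unique (hF (star a))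
              (by simpa [map_star] using (hF a).star) }, hF, fun b => ?_⟩
  refine tendsto_nhds_unique (hF b).norm ?_
  simp [hiso]

variable {B C : Type*} [NonUnitalCStarAlgebra B] [NonUnitalCStarAlgebra C]

lemma norm_starAlgEquiv_apply {C' : Type*} [NonUnitalCStarAlgebra C'] (σ : C ≃⋆ₐ[ℂ] C') (c : C) :
    ‖σ c‖ = ‖c‖ :=
  NonUnitalStarAlgHom.norm_map σ (EquivLike.injective σ) c

lemma exists_intertwining_step (ι : B →⋆ₙₐ[ℂ] C)
    (l : Filter (C ≃⋆ₐ[ℂ] C)) [l.NeBot]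
    (h1 : ∀ b, Tendsto (fun σ : C ≃⋆ₐ[ℂ] C => ‖σ (ι b) - ι b‖) l (𝓝 0))
    (h2 : ∀ c, Tendsto (fun σ : C ≃⋆ₐ[ℂ] C => Metric.infDist (σ c) (Set.range ι)) l (𝓝 0))
    (τ : C ≃⋆ₐ[ℂ] C) (S : Finset B) (F : Finset B) (G : Finset C) {ε : ℝ} (hε : 0 < ε) :
    ∃ (τ' : C ≃⋆ₐ[ℂ] C) (S' : Finset B), S ⊆ S' ∧ F ⊆ S' ∧
      (∀ b ∈ S, ‖τ' (ι b) - τ (ι b)‖ < ε) ∧ ∀ c ∈ G, ∃ b ∈ S', ‖τ' (ι b) - c‖ < ε := by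
  classical
  have e1 : ∀ᶠ σ in l, ∀ b ∈ S, ‖σ (ι b) - ι b‖ < ε := by
    rw [Filter.eventually_all_finset]
    exact fun b _ => (h1 b).eventually (gt_mem_nhds hε)
  have e2 : ∀ᶠ σ in l, ∀ c ∈ G, Metric.infDist (σ (τ.symm c)) (Set.range ι) < ε := by
    rw [Filter.eventually_all_finset]
    exact fun c _ => (h2 _).eventually (gt_mem_nhds hε)
  obtain ⟨σ, hσ1, hσ2⟩ := (e1.and e2).exists
  have hb : ∀ c ∈ G, ∃ b, ‖ι b - σ (τ.symm c)‖ < ε := by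
    intro c hc
    obtain ⟨_, ⟨b, rfl⟩, hb⟩ := (Metric.infDist_lt_iff ⟨_, Set.mem_range_self 0⟩).1 (hσ2 c hc)
    exact ⟨b, by rwa [← dist_eq_norm, dist_comm]⟩
  choose! f hf using hb
  refine ⟨σ.symm.trans τ, S ∪ F ∪ G.image f, ?_, ?_, fun b hbS => ?_, fun c hc => ⟨f c, ?_, ?_⟩⟩
  · intro x hx; simp [hx]
  · intro x hx; simp [hx]
  · have : (σ.symm.trans τ) (ι b) - τ (ι b) = τ (σ.symm (ι b - σ (ι b))) := by
      simp [StarAlgEquiv.trans_apply]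
    rw [this, norm_starAlgEquiv_apply, norm_starAlgEquiv_apply, norm_sub_rev]
    exact hσ1 b hbS
  · simp only [Finset.mem_union, Finset.mem_image]
    exact Or.inr ⟨c, hc, rfl⟩
  · have : (σ.symm.trans τ) (ι (f c)) - c = τ (σ.symm (ι (f c) - σ (τ.symm c))) := by
      simp [StarAlgEquiv.trans_apply]
    rw [this, norm_starAlgEquiv_apply, norm_starAlgEquiv_apply]
    exact hf c hc

/-- One-sided approximate intertwining. -/
theorem nonempty_starAlgEquiv_of_intertwining [TopologicalSpace.SeparableSpace B]
    [TopologicalSpace.SeparableSpace C] (ι : B →⋆ₙₐ[ℂ] C) (hι : ∀ b, ‖ι b‖ = ‖b‖)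
    (l : Filter (C ≃⋆ₐ[ℂ] C)) [l.NeBot]
    (h1 : ∀ b, Tendsto (fun σ : C ≃⋆ₐ[ℂ] C => ‖σ (ι b) - ι b‖) l (𝓝 0))
    (h2 : ∀ c, Tendsto (fun σ : C ≃⋆ₐ[ℂ] C => Metric.infDist (σ c) (Set.range ι)) l (𝓝 0)) :
    Nonempty (C ≃⋆ₐ[ℂ] B) := by
  classical
  let bs := TopologicalSpace.denseSeq B
  let cs := TopologicalSpace.denseSeq C
  have step : ∀ (n : ℕ) (p : (C ≃⋆ₐ[ℂ] C) × Finset B), ∃ q : (C ≃⋆ₐ[ℂ] C) × Finset B,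
      p.2 ⊆ q.2 ∧ (Finset.range (n + 1)).image bs ⊆ q.2 ∧
      (∀ b ∈ p.2, ‖q.1 (ι b) - p.1 (ι b)‖ < (1 / 2 : ℝ) ^ n) ∧
      ∀ c ∈ (Finset.range (n + 1)).image cs, ∃ b ∈ q.2, ‖q.1 (ι b) - c‖ < (1 / 2 : ℝ) ^ n := by
    intro n p
    obtain ⟨τ', S', h⟩ := exists_intertwining_step ι l h1 h2 p.1 p.2
      ((Finset.range (n + 1)).image bs) ((Finset.range (n + 1)).image cs)
      (ε := (1 / 2 : ℝ) ^ n) (by positivity)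
    exact ⟨(τ', S'), h⟩
  choose nxt hn1 hn2 hn3 hn4 using step
  let st : ℕ → (C ≃⋆ₐ[ℂ] C) × Finset B := fun n =>
    Nat.rec (StarAlgEquiv.refl ℂ C, ∅) (fun n p => nxt n p) n
  have hst : ∀ n, st (n + 1) = nxt n (st n) := fun n => rfl
  have hmono : Monotone fun n => (st n).2 :=
    monotone_nat_of_le_succ fun n => by rw [hst]; exact hn1 n _
  have hclose : ∀ n b, b ∈ (st n).2 → ∀ m,
      dist ((st (n + m)).1 (ι b)) ((st (n + (m + 1))).1 (ι b)) ≤ (1 / 2 : ℝ) ^ n * (1 / 2) ^ m := by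
    intro n b hb m
    rw [dist_comm, dist_eq_norm, ← add_assoc, hst, ← pow_add]
    exact (hn3 _ _ b (hmono (Nat.le_add_right n m) hb)).le
  obtain ⟨θ, hθ, hθn⟩ := exists_starHom_limit (l := atTop) (S := Set.range bs)
    ((TopologicalSpace.denseRange_denseSeq B).mono Submodule.subset_span)
    (fun n => ((st n).1 : C →⋆ₙₐ[ℂ] C).comp ι)
    (fun n b => by simpa [hι] using norm_starAlgEquiv_apply (st n).1 (ι b)) (by
      rintro _ ⟨k, rfl⟩
      have hmem : bs k ∈ (st (k + 1)).2 := by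
        rw [hst]; exact hn2 _ _ (Finset.mem_image_of_mem _ (by simp))
      obtain ⟨y, hy⟩ := cauchySeq_tendsto_of_complete
        (cauchySeq_of_le_geometric (1 / 2 : ℝ) ((1 / 2 : ℝ) ^ (k + 1)) (by norm_num)
          (hclose (k + 1) _ hmem))
      refine ⟨y, ?_⟩
      have := (tendsto_add_atTop_iff_nat (f := fun n => (st n).1 (ι (bs k))) (k + 1)).1
        (by simpa [add_comm] using hy)
      simpa using this)
  replace hθ : ∀ b, Tendsto (fun n => (st n).1 (ι b)) atTop (𝓝 (θ b)) := by simpa using hθ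
  have hinj : Isometry θ := AddMonoidHomClass.isometry_of_norm θ hθn
  have hdense : DenseRange θ := by
    intro c
    rw [Metric.mem_closure_iff]
    intro ε hε
    obtain ⟨N, hN⟩ := exists_pow_lt_of_lt_one (show 0 < ε / 3 by positivity)
      (show (1 / 2 : ℝ) < 1 by norm_num)
    obtain ⟨k, hk⟩ := Metric.denseRange_iff.1 (TopologicalSpace.denseRange_denseSeq C) c (ε / 3)
      (by positivity)
    set n := max N k
    obtain ⟨b, hb, hbk⟩ := hn4 n (st n) (cs k)
      (Finset.mem_image_of_mem _ (by simp [n]))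
    have hpow : (1 / 2 : ℝ) ^ n ≤ (1 / 2) ^ N :=
      pow_le_pow_of_le_one (by norm_num) (by norm_num) (le_max_left _ _)
    have hlim : Tendsto (fun m => (st (n + 1 + m)).1 (ι b)) atTop (𝓝 (θ b)) := by
      have := (tendsto_add_atTop_iff_nat (f := fun n => (st n).1 (ι b)) (n + 1)).2 (hθ b)
      simpa [add_comm, add_left_comm] using this
    have hd := dist_le_of_le_geometric_of_tendsto₀ (1 / 2 : ℝ) ((1 / 2 : ℝ) ^ (n + 1))
      (by norm_num) (hclose (n + 1) b hb) hlim
    refine ⟨θ b, Set.mem_range_self b, ?_⟩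
    rw [← hst, ← dist_eq_norm] at hbk
    have h5 : (1 / 2 : ℝ) ^ (n + 1) / (1 - 1 / 2) = (1 / 2) ^ n := by
      rw [pow_succ]; ring
    simp only [add_zero] at hd
    rw [h5] at hd
    change dist c (cs k) < ε / 3 at hk
    have h6 := dist_triangle c (cs k) (θ b)
    have h7 := dist_triangle_left (cs k) (θ b) ((st (n + 1)).1 (ι b))
    linarith
  have hsurj : Function.Surjective θ := by
    rw [← Set.range_eq_univ, ← hdense.closure_range]
    exact (hinj.isClosedEmbedding.isClosed_range.closure_eq).symm
  exact ⟨(StarAlgEquiv.ofBijective θ ⟨hinj.injective, hsurj⟩).symm⟩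

end Intertwining

section AU

/-- Conjugation by unitaries of a unital C*-algebra carries `f` to `g` pointwise along some
filter. -/
def AU {X R : Type*} [CStarAlgebra R] (f g : X → R) : Prop :=
  ∃ l : Filter (unitary R), l.NeBot ∧
    ∀ a, Tendsto (fun V : unitary R => (V : R) * f a * star (V : R)) l (𝓝 (g a))

variable {X R : Type*} [CStarAlgebra R] {f g h : X → R}

lemma tendsto_mul_mul_star_unitary {I : Type*} {l : Filter I} (V : I → unitary R) {a : I → R} {b c : R}
    (h1 : Tendsto a l (𝓝 b))
    (h2 : Tendsto (fun i => (V i : R) * b * star (V i : R)) l (𝓝 c)) :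
    Tendsto (fun i => (V i : R) * a i * star (V i : R)) l (𝓝 c) := by
  have h3 : Tendsto (fun i => (V i : R) * (a i - b) * star (V i : R)) l (𝓝 0) := by
    rw [tendsto_zero_iff_norm_tendsto_zero] at *
    refine (tendsto_zero_iff_norm_tendsto_zero.1 (tendsto_sub_nhds_zero_iff.2 h1)).congr fun i => ?_
    rw [← Unitary.coe_star, CStarRing.norm_mul_coe_unitary, CStarRing.norm_coe_unitary_mul]
  simpa [mul_sub, sub_mul] using h3.add h2

lemma AU.of_tendsto {I : Type*} {l : Filter I} [l.NeBot] (V : I → unitary R)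
    (hV : ∀ a, Tendsto (fun i => (V i : R) * f a * star (V i : R)) l (𝓝 (g a))) : AU f g :=
  ⟨l.map V, inferInstance, fun a => tendsto_map'_iff.2 (hV a)⟩

lemma AU.symm (H : AU f g) : AU g f := by
  obtain ⟨l, hl, H⟩ := H
  refine AU.of_tendsto (l := l) (fun V => star V) fun a => ?_
  have := H a
  rw [← tendsto_sub_nhds_zero_iff, tendsto_zero_iff_norm_tendsto_zero] at this ⊢
  refine this.congr fun V => ?_
  have h1 : ((star V : unitary R) : R) * g a * star ((star V : unitary R) : R) - f a
      = ((star V : unitary R) : R) * (g a - V * f a * star (V : R)) * V := by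
    have h0 : (star (V : R)) * V = 1 := Unitary.coe_star_mul_self V
    simp only [Unitary.coe_star, star_star, mul_sub, sub_mul, mul_assoc, h0, mul_one]
    simp only [← mul_assoc, h0, one_mul]
  rw [h1, CStarRing.norm_mul_coe_unitary, CStarRing.norm_coe_unitary_mul, norm_sub_rev]

lemma AU.trans (H : AU f g) (H' : AU g h) : AU f h := by
  obtain ⟨l, hl, H⟩ := H
  obtain ⟨l', hl', H'⟩ := H'
  refine AU.of_tendsto (l := l ×ˢ l') (fun V => V.2 * V.1) fun a => ?_
  have := tendsto_mul_mul_star_unitary (l := l ×ˢ l') (fun V => V.2) (c := h a) ((H a).comp tendsto_fst)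
    ((H' a).comp tendsto_snd)
  refine this.congr fun V => ?_
  simp [mul_assoc]

lemma AU.comp {Y : Type*} (H : AU f g) (k : Y → X) : AU (fun y => f (k y)) (fun y => g (k y)) :=
  ⟨H.choose, H.choose_spec.1, fun a => H.choose_spec.2 (k a)⟩

lemma AU.map {R' : Type*} [CStarAlgebra R'] (H : AU f g) (ρ : R →⋆ₐ[ℂ] R') :
    AU (fun y => ρ (f y)) (fun y => ρ (g y)) := by
  obtain ⟨l, hl, H⟩ := H
  refine AU.of_tendsto (l := l) (fun V => ⟨ρ V, Unitary.map_mem ρ V.2⟩) fun a => ?_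
  have := ((map_continuous ρ).tendsto _).comp (H a)
  refine this.congr fun V => ?_
  simp [map_star]

lemma coe_fst_one {T : Type*} [CStarAlgebra T] (x : 𝓜(ℂ, T)) :
    ((x.fst 1 : T) : 𝓜(ℂ, T)) = x := by
  have h1 : ∀ t, x.fst t = x.snd 1 * t := fun t => by
    have := x.central 1 t; rw [one_mul] at this; exact this.symm
  have h2 : ∀ t, x.snd t = t * x.fst 1 := fun t => by
    have := x.central t 1; rw [mul_one] at this; exact this
  refine DoubleCentralizer.ext _ _ _ _ (Prod.ext ?_ ?_)
  · ext t
    change x.fst 1 * t = x.fst t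
    rw [h1 1, mul_one, h1 t]
  · ext t
    change t * x.fst 1 = x.snd t
    rw [h2 t]

lemma coeHom_injective {T : Type*} [NonUnitalCStarAlgebra T] :
    Function.Injective (DoubleCentralizer.coeHom (𝕜 := ℂ) (A := T)) := by
  rw [injective_iff_map_eq_zero]
  intro a ha
  have h1 : (DoubleCentralizer.coeHom (𝕜 := ℂ) a).fst (star a) = 0 := by rw [ha]; rfl
  exact CStarRing.mul_star_self_eq_zero_iff a |>.1 h1

lemma norm_coeHom {T : Type*} [NonUnitalCStarAlgebra T] (a : T) :
    ‖DoubleCentralizer.coeHom (𝕜 := ℂ) a‖ = ‖a‖ :=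
  NonUnitalStarAlgHom.norm_map _ coeHom_injective a

/-- For unital codomains, approximate unitary equivalence may be tested with unitaries of the
algebra itself. -/
lemma ApproxUnitaryEquiv.au {A T : Type*} [CStarAlgebra T] {f g : A → T}
    (H : ApproxUnitaryEquiv f g) : AU f g := by
  obtain ⟨v, hv, H⟩ := H
  let ρ := DoubleCentralizer.coeHom (𝕜 := ℂ) (A := T)
  have hρ1 : ρ 1 = 1 := DoubleCentralizer.ext _ _ _ _
    (Prod.ext (by ext t; exact one_mul t) (by ext t; exact mul_one t))
  have hρ : ∀ n, ρ ((v n).fst 1) = v n := fun n => coe_fst_one (v n)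
  have hu : ∀ n, (v n).fst 1 ∈ unitary T := fun n => by
    refine Unitary.mem_iff.2 ⟨coeHom_injective ?_, coeHom_injective ?_⟩ <;>
    · change ρ _ = ρ 1
      rw [map_mul, map_star, hρ, hρ1]
      first | exact Unitary.star_mul_self_of_mem (hv n) | exact Unitary.mul_star_self_of_mem (hv n)
  refine AU.of_tendsto (l := atTop) (fun n => star ⟨(v n).fst 1, hu n⟩) fun a => ?_
  rw [← tendsto_sub_nhds_zero_iff, tendsto_zero_iff_norm_tendsto_zero]
  refine (H a).congr fun n => ?_
  rw [← norm_coeHom (T := T)]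
  congr 1
  change _ = ρ _
  simp only [map_sub, map_mul, map_star, Unitary.coe_star, star_star, hρ]
  rfl

end AU

section Flip

/-- A star homomorphism between unital C*-algebras preserving the unit. -/
def NonUnitalStarAlgHom.toUnital {A B : Type*} [CStarAlgebra A] [CStarAlgebra B]
    (f : A →⋆ₙₐ[ℂ] B) (h1 : f 1 = 1) : A →⋆ₐ[ℂ] B where
  toFun := f
  map_one' := h1
  map_mul' := map_mul f
  map_zero' := map_zero f
  map_add' := map_add f
  commutes' c := by rw [Algebra.algebraMap_eq_smul_one, Algebra.algebraMap_eq_smul_one, map_smul, h1]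
  map_star' := map_star f

lemma CStarTensor.hom_ext {A B T T' : Type*} [NonUnitalCStarAlgebra A]
    [NonUnitalCStarAlgebra B] [NonUnitalCStarAlgebra T] [NonUnitalCStarAlgebra T']
    (h : CStarTensor A B T) {f g : T →⋆ₙₐ[ℂ] T'}
    (H : ∀ a b, f (h.tmul a b) = g (h.tmul a b)) (t : T) : f t = g t := by
  let F : T →L[ℂ] T' :=
    ⟨{ toFun := f, map_add' := map_add f, map_smul' := map_smul f }, map_continuous f⟩
  let G : T →L[ℂ] T' :=
    ⟨{ toFun := g, map_add' := map_add g, map_smul' := map_smul g }, map_continuous g⟩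
  have : F = G := ContinuousLinearMap.ext_on h.dense_span (by rintro _ ⟨a, b, rfl⟩; exact H a b)
  exact DFunLike.congr_fun this t

lemma CStarTensor.zero_left {A B T : Type*} [NonUnitalCStarAlgebra A]
    [NonUnitalCStarAlgebra B] [NonUnitalCStarAlgebra T] (h : CStarTensor A B T) (b : B) :
    h.tmul 0 b = 0 := by
  simpa using h.smul_left 0 0 b

lemma CStarTensor.zero_right {A B T : Type*} [NonUnitalCStarAlgebra A]
    [NonUnitalCStarAlgebra B] [NonUnitalCStarAlgebra T] (h : CStarTensor A B T) (a : A) :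
    h.tmul a 0 = 0 := by
  simpa using h.smul_right 0 a 0

/-- The first-factor embedding as a star homomorphism. -/
def CStarTensor.inl {A D T : Type*} [NonUnitalCStarAlgebra A] [CStarAlgebra D]
    [NonUnitalCStarAlgebra T] (h : CStarTensor A D T) : A →⋆ₙₐ[ℂ] T where
  toFun a := h.tmul a 1
  map_smul' c a := h.smul_left c a 1
  map_zero' := h.zero_left 1
  map_add' a b := h.add_left a b 1
  map_mul' a b := by rw [h.mul_tmul, one_mul]
  map_star' a := by rw [h.star_tmul, star_one]

/-- The second-factor embedding as a star homomorphism. -/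
def CStarTensor.inr {A D T : Type*} [CStarAlgebra A] [NonUnitalCStarAlgebra D]
    [NonUnitalCStarAlgebra T] (h : CStarTensor A D T) : D →⋆ₙₐ[ℂ] T where
  toFun a := h.tmul 1 a
  map_smul' c a := h.smul_right c 1 a
  map_zero' := h.zero_right 1
  map_add' a b := h.add_right 1 a b
  map_mul' a b := by rw [h.mul_tmul, one_mul]
  map_star' a := by rw [h.star_tmul, star_one]

lemma CStarTensor.inl_apply {A D T : Type*} [NonUnitalCStarAlgebra A] [CStarAlgebra D]
    [NonUnitalCStarAlgebra T] (h : CStarTensor A D T) (a : A) : h.inl a = h.tmul a 1 := rfl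

variable {D TD : Type u} [CStarAlgebra D] [CStarAlgebra TD]

/-- The flip of a minimal tensor square. -/
lemma MinTensor.exists_flip (hD : MinTensor D D TD) (hDu : hD.tmul 1 1 = 1) :
    ∃ σ : TD →⋆ₐ[ℂ] TD, (∀ a b, σ (hD.tmul a b) = hD.tmul b a) ∧ ∀ t, σ (σ t) = t := by
  obtain ⟨π, hπ⟩ := hD.minimal TD
    { tmul := fun a b => hD.tmul b a
      add_left := fun a a' b => hD.add_right _ _ _
      add_right := fun a a' b => hD.add_left _ _ _
      smul_left := fun c a b => hD.smul_right _ _ _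
      smul_right := fun c a b => hD.smul_left _ _ _
      mul_tmul := fun a a' b b' => hD.mul_tmul _ _ _ _
      star_tmul := fun a b => hD.star_tmul _ _
      norm_tmul := fun a b => (hD.norm_tmul _ _).trans (mul_comm _ _)
      dense_span := by
        convert hD.dense_span using 4
        ext t
        exact exists_comm }
  refine ⟨π.toUnital (by rw [← hDu]; exact hπ 1 1), fun a b => hπ b a, fun t => ?_⟩
  exact hD.hom_ext (f := π.comp π) (g := NonUnitalStarAlgHom.id ℂ TD)
    (fun a b => (congrArg π (hπ b a)).trans (hπ a b)) t

/-- Amplification of an involutive automorphism on the second factor. -/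
lemma MinTensor.exists_amplification (hD : MinTensor D D TD) (hDu : hD.tmul 1 1 = 1)
    (θ : D →⋆ₐ[ℂ] D) (hθ : ∀ d, θ (θ d) = d) :
    ∃ Ω : TD →⋆ₐ[ℂ] TD, ∀ a b, Ω (hD.tmul a b) = hD.tmul a (θ b) := by
  obtain ⟨π, hπ⟩ := hD.minimal TD
    { tmul := fun a b => hD.tmul a (θ b)
      add_left := fun a a' b => hD.add_left _ _ _
      add_right := fun a a' b => by rw [map_add, hD.add_right]
      smul_left := fun c a b => hD.smul_left _ _ _
      smul_right := fun c a b => by rw [map_smul, hD.smul_right]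
      mul_tmul := fun a a' b b' => by rw [hD.mul_tmul, map_mul]
      star_tmul := fun a b => by rw [hD.star_tmul, map_star]
      norm_tmul := fun a b => by
        rw [hD.norm_tmul, NonUnitalStarAlgHom.norm_map θ (Function.LeftInverse.injective hθ) b]
      dense_span := by
        convert hD.dense_span using 4
        ext t
        refine exists_congr fun a => ⟨fun ⟨b, hb⟩ => ⟨θ b, hb⟩, fun ⟨b, hb⟩ => ⟨θ b, ?_⟩⟩
        rw [hθ, hb] }
  have hπ' : ∀ a b, π (hD.tmul a b) = hD.tmul a (θ b) := fun a b => by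
    have : π (hD.tmul a (θ (θ b))) = hD.tmul a (θ b) := hπ a (θ b)
    rwa [hθ] at this
  exact ⟨π.toUnital (by rw [← hDu, hπ', map_one]), hπ'⟩

/-- In a strongly self-absorbing algebra, both factor embeddings, transported to the algebra
itself, are approximately inner. -/
lemma MinTensor.au_factor_embeddings (hD : MinTensor D D TD) (hDu : hD.tmul 1 1 = 1)
    (φ : D ≃⋆ₐ[ℂ] TD) (hφ : AU φ hD.fst) :
    AU (fun d : D => d) (fun d => φ.symm (hD.tmul d 1)) ∧
      AU (fun d : D => d) (fun d => φ.symm (hD.tmul 1 d)) := by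
  obtain ⟨σ, hσ, hσσ⟩ := hD.exists_flip hDu
  let φs : TD →⋆ₐ[ℂ] D := φ.symm
  let φh : D →⋆ₐ[ℂ] TD := φ
  let θ : D →⋆ₐ[ℂ] D := φs.comp (σ.comp φh)
  have hθa : ∀ d, θ d = φ.symm (σ (φ d)) := fun d => rfl
  have hθ : ∀ d, θ (θ d) = d := fun d => by simp [hθa, hσσ]
  obtain ⟨Ω, hΩ⟩ := hD.exists_amplification hDu θ hθ
  have hid : AU (fun d : D => d) (fun d => φ.symm (hD.tmul d 1)) := by
    have := hφ.map φs
    have h2 : (fun y => φs (φ y)) = fun d : D => d := by ext y; exact φ.symm_apply_apply y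
    rwa [h2] at this
  have h1 : AU (fun d => Ω (φ d)) φ := by
    have h2 := hφ.map Ω
    have h3 : (fun y => Ω (hD.fst y)) = hD.fst := by
      ext y; simp [MinTensor.fst, hΩ]
    rw [h3] at h2
    exact h2.trans hφ.symm
  have h2 : AU (fun t => Ω t) (fun t : TD => t) := by
    have := h1.comp φ.symm
    simpa using this
  have h3 : AU (fun d => φ.symm (hD.tmul (θ d) 1)) (fun d => φ.symm (hD.tmul d 1)) := by
    have := ((h2.comp (fun d => hD.tmul 1 d)).map σ).map φs
    simpa [hΩ, hσ, φs] using this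
  have h4 : AU (fun d => θ d) (fun d : D => d) :=
    ((hid.comp θ).trans h3).trans hid.symm
  refine ⟨hid, ?_⟩
  have h5 := h4.comp (fun d => φ.symm (hD.tmul d 1))
  have h6 : (fun d => θ (φ.symm (hD.tmul d 1))) = fun d => φ.symm (hD.tmul 1 d) := by
    ext d; simp [hθa, hσ]
  rw [h6] at h5
  exact (h5.trans hid.symm).symm

end Flip

section Simple

lemma exists_resolvent_contraction {D : Type*} [CStarAlgebra D] [PartialOrder D]
    [StarOrderedRing D] {h : D} (h0 : 0 ≤ h) {δ : ℝ} (hδ : 0 < δ) :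
    ∃ x c : D, star x = x ∧ ‖x‖ ≤ 1 ∧ 1 - x = h * c ∧ ‖x * h * x‖ ≤ δ := by
  have hsa : IsSelfAdjoint h := IsSelfAdjoint.of_nonneg h0
  have hsp : ∀ t ∈ spectrum ℝ h, 0 ≤ t := fun t ht => spectrum_nonneg_of_nonneg h0 ht
  have hc : ContinuousOn (fun t : ℝ => δ / (t + δ)) (spectrum ℝ h) :=
    ContinuousOn.div (by fun_prop) (by fun_prop) fun t ht => (by linarith [hsp t ht] : 0 < t + δ).ne'
  have hc1 : ContinuousOn (fun t : ℝ => 1 / (t + δ)) (spectrum ℝ h) :=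
    ContinuousOn.div (by fun_prop) (by fun_prop) fun t ht => (by linarith [hsp t ht] : 0 < t + δ).ne'
  have hid : ContinuousOn (fun t : ℝ => t) (spectrum ℝ h) := continuousOn_id
  refine ⟨cfc (fun t : ℝ => δ / (t + δ)) h, cfc (fun t : ℝ => 1 / (t + δ)) h,
    (cfc_predicate (fun t : ℝ => δ / (t + δ)) h : IsSelfAdjoint _).star_eq, ?_, ?_, ?_⟩
  · refine norm_cfc_le zero_le_one fun t ht => ?_
    have := hsp t ht
    rw [Real.norm_of_nonneg (by positivity), div_le_one (by positivity)]
    linarith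
  · have h1 : h * cfc (fun t : ℝ => 1 / (t + δ)) h = cfc (fun t : ℝ => t * (1 / (t + δ))) h := by
      rw [cfc_mul (fun t : ℝ => t) (fun t : ℝ => 1 / (t + δ)) h hid hc1, cfc_id' ℝ h hsa]
    rw [h1, ← cfc_const_one ℝ h hsa, ← cfc_sub (fun _ : ℝ => (1 : ℝ)) (fun t : ℝ => δ / (t + δ)) h
      continuousOn_const hc]
    refine cfc_congr fun t ht => ?_
    have := hsp t ht
    have h3 : t + δ ≠ 0 := by positivity
    field_simp
    ring
  · have h1 : cfc (fun t : ℝ => δ / (t + δ)) h * h * cfc (fun t : ℝ => δ / (t + δ)) h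
        = cfc (fun t : ℝ => δ / (t + δ) * t * (δ / (t + δ))) h := by
      rw [cfc_mul (fun t : ℝ => δ / (t + δ) * t) (fun t : ℝ => δ / (t + δ)) h (hc.mul hid) hc,
        cfc_mul (fun t : ℝ => δ / (t + δ)) (fun t : ℝ => t) h hc hid, cfc_id' ℝ h hsa]
    rw [h1]
    refine norm_cfc_le hδ.le fun t ht => ?_
    have := hsp t ht
    rw [Real.norm_of_nonneg (by positivity)]
    have h3 : δ / (t + δ) ≤ 1 := by rw [div_le_one (by positivity)]; linarith
    have h4 : δ / (t + δ) * t ≤ δ := by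
      rw [div_mul_eq_mul_div, div_le_iff₀ (by positivity)]
      nlinarith
    calc δ / (t + δ) * t * (δ / (t + δ)) ≤ δ * 1 := by gcongr
      _ = δ := mul_one δ

/-- Ideal contractions almost annihilating finitely many elements of an ideal from the left. -/
lemma exists_norm_le_one_norm_mul_lt {D : Type*} [CStarAlgebra D] {K : AddSubgroup D}
    (hr : ∀ a, ∀ x ∈ K, x * a ∈ K) {n : ℕ} (z : Fin n → D)
    (hz : ∀ i, z i ∈ K) {ε : ℝ} (hε : 0 < ε) :
    ∃ x : D, ‖x‖ ≤ 1 ∧ 1 - x ∈ K ∧ ∀ i, ‖x * z i‖ ≤ ε := by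
  let := CStarAlgebra.spectralOrder D
  have := CStarAlgebra.spectralOrderedRing D
  have hpos : ∀ i, 0 ≤ z i * star (z i) := fun i => mul_star_self_nonneg _
  obtain ⟨x, c, hxs, hx1, hxc, hxh⟩ := exists_resolvent_contraction
    (Finset.sum_nonneg fun i (_ : i ∈ Finset.univ) => hpos i) (pow_pos hε 2)
  refine ⟨x, hx1, ?_, fun i => ?_⟩
  · rw [hxc]
    exact hr _ _ (K.sum_mem fun i _ => hr _ _ (hz i))
  · have h4 : z i * star (z i) ≤ ∑ j, z j * star (z j) :=
      Finset.single_le_sum (fun j _ => hpos j) (Finset.mem_univ i)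
    have h3 := star_right_conjugate_le_conjugate h4 x
    rw [hxs] at h3
    have h7 : x * z i * star (x * z i) = x * (z i * star (z i)) * x := by
      rw [star_mul, hxs]; simp only [mul_assoc]
    rw [← h7] at h3
    have h6 := (CStarAlgebra.norm_le_norm_of_nonneg_of_le (mul_star_self_nonneg _) h3).trans hxh
    rw [CStarRing.norm_self_mul_star, ← sq] at h6
    exact (sq_le_sq₀ (norm_nonneg _) hε.le).1 h6

/-- A C*-algebra with approximately inner half flip is algebraically simple. -/
lemma one_mem_of_au_half_flip {D TD : Type*} [CStarAlgebra D] [CStarAlgebra TD]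
    (hD : CStarTensor D D TD)
    (hflip : AU (fun d => hD.tmul d 1) fun d => hD.tmul 1 d) {K : AddSubgroup D}
    (hl : ∀ a, ∀ x ∈ K, a * x ∈ K) (hr : ∀ a, ∀ x ∈ K, x * a ∈ K) {y : D} (hy : y ∈ K)
    (hy0 : y ≠ 0) : 1 ∈ K := by
  have : Nontrivial D := ⟨y, 0, hy0⟩
  set s : Set TD := {t | ∃ a ∈ K, ∃ b, hD.tmul a b = t} with hs
  set L : Submodule ℂ TD := (Submodule.span ℂ s).topologicalClosure with hL
  have hsL : ∀ a ∈ K, ∀ b, hD.tmul a b ∈ L := fun a ha b =>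
    Submodule.le_topologicalClosure _ (Submodule.subset_span ⟨a, ha, b, rfl⟩)
  have hLc : IsClosed (L : Set TD) := Submodule.isClosed_topologicalClosure _
  have hsub : ∀ F : TD →L[ℂ] TD, (∀ a ∈ K, ∀ b, F (hD.tmul a b) ∈ L) → ∀ z ∈ L, F z ∈ L := by
    intro F hF z hz
    have h1 : Submodule.span ℂ s ≤ L.comap (F : TD →ₗ[ℂ] TD) := by
      rw [Submodule.span_le]
      rintro _ ⟨a, ha, b, rfl⟩
      exact hF a ha b
    exact Submodule.topologicalClosure_minimal _ h1 (hLc.preimage F.continuous) hz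
  have hclos : ∀ x : TD, (∀ ε > 0, ∃ y, y ∈ L ∧ ‖x - y‖ < ε) → x ∈ L := fun x hx => by
    rw [← SetLike.mem_coe, ← hLc.closure_eq, Metric.mem_closure_iff]
    intro ε hε
    obtain ⟨y, hy, hxy⟩ := hx ε hε
    exact ⟨y, hy, by rwa [dist_eq_norm]⟩
  have hleft : ∀ p : TD, ∀ z ∈ L, p * z ∈ L := by
    intro p z hz
    refine hsub (ContinuousLinearMap.mul ℂ TD p) (fun a ha b => ?_) z hz
    have : (ContinuousLinearMap.mul ℂ TD).flip (hD.tmul a b) p ∈ L := by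
      have h1 : (⊤ : Submodule ℂ TD) ≤
          L.comap ((ContinuousLinearMap.mul ℂ TD).flip (hD.tmul a b) : TD →ₗ[ℂ] TD) := by
        rw [← Submodule.dense_iff_topologicalClosure_eq_top.1 hD.dense_span]
        refine Submodule.topologicalClosure_minimal _ ?_ (hLc.preimage (ContinuousLinearMap.continuous _))
        rw [Submodule.span_le]
        rintro _ ⟨c, d, rfl⟩
        change hD.tmul c d * hD.tmul a b ∈ L
        rw [hD.mul_tmul]
        exact hsL _ (hl _ _ ha) _
      exact h1 (x := p) trivial
    exact this
  have hright : ∀ p : TD, ∀ z ∈ L, z * p ∈ L := by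
    intro p z hz
    refine hsub ((ContinuousLinearMap.mul ℂ TD).flip p) (fun a ha b => ?_) z hz
    have : ContinuousLinearMap.mul ℂ TD (hD.tmul a b) p ∈ L := by
      have h1 : (⊤ : Submodule ℂ TD) ≤
          L.comap (ContinuousLinearMap.mul ℂ TD (hD.tmul a b) : TD →ₗ[ℂ] TD) := by
        rw [← Submodule.dense_iff_topologicalClosure_eq_top.1 hD.dense_span]
        refine Submodule.topologicalClosure_minimal _ ?_ (hLc.preimage (ContinuousLinearMap.continuous _))
        rw [Submodule.span_le]
        rintro _ ⟨c, d, rfl⟩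
        change hD.tmul a b * hD.tmul c d ∈ L
        rw [hD.mul_tmul]
        exact hsL _ (hr _ _ ha) _
      exact h1 (x := p) trivial
    exact this
  have hyL : hD.tmul 1 y ∈ L := by
    obtain ⟨l, hl', H⟩ := hflip
    exact hLc.mem_of_tendsto (H y) (Eventually.of_forall fun V =>
      hright _ _ (hleft _ _ (hsL y hy 1)))
  have hyn : 0 < ‖y‖ := norm_pos_iff.2 hy0
  obtain ⟨z, hz, hyz⟩ := Metric.mem_closure_iff.1
    (show hD.tmul 1 y ∈ closure ((Submodule.span ℂ s : Submodule ℂ TD) : Set TD) from hyL)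
    (‖y‖ / 2) (by positivity)
  obtain ⟨n, f, g, hfg⟩ := Submodule.mem_span_set'.1 hz
  choose a haK b hab using fun i => (g i).2
  set M : ℝ := ∑ i, ‖f i‖ * ‖b i‖
  have hM : 0 ≤ M := Finset.sum_nonneg fun i _ => by positivity
  obtain ⟨e, he1, heK, he⟩ := exists_norm_le_one_norm_mul_lt hr a haK
    (ε := ‖y‖ / 4 / (M + 1)) (by positivity)
  have h1 : ‖hD.tmul e 1 * z‖ ≤ ‖y‖ / 4 := by
    rw [← hfg, Finset.mul_sum]
    calc ‖∑ i, hD.tmul e 1 * f i • (g i : TD)‖ ≤ ∑ i, ‖hD.tmul e 1 * f i • (g i : TD)‖ :=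
          norm_sum_le _ _
      _ ≤ ∑ i, (‖y‖ / 4 / (M + 1)) * (‖f i‖ * ‖b i‖) := by
          refine Finset.sum_le_sum fun i _ => ?_
          rw [← hab, mul_smul_comm, hD.mul_tmul, one_mul, norm_smul, hD.norm_tmul]
          have := he i
          calc ‖f i‖ * (‖e * a i‖ * ‖b i‖) ≤ ‖f i‖ * ((‖y‖ / 4 / (M + 1)) * ‖b i‖) := by gcongr
            _ = _ := by ring
      _ = (‖y‖ / 4 / (M + 1)) * M := by rw [← Finset.mul_sum]
      _ ≤ ‖y‖ / 4 := by
          rw [div_mul_eq_mul_div, div_le_iff₀ (by positivity)]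
          nlinarith
  have h2 : ‖e‖ * ‖y‖ < ‖y‖ := by
    have h3 : hD.tmul e y = hD.tmul e 1 * (hD.tmul 1 y - z) + hD.tmul e 1 * z := by
      rw [← mul_add, sub_add_cancel, hD.mul_tmul, mul_one, one_mul]
    rw [← hD.norm_tmul, h3]
    have h4 : ‖hD.tmul e 1‖ ≤ 1 := by
      rw [hD.norm_tmul]
      exact mul_le_one₀ he1 (norm_nonneg _) CStarRing.norm_one.le
    rw [dist_eq_norm] at hyz
    calc _ ≤ ‖hD.tmul e 1 * (hD.tmul 1 y - z)‖ + ‖hD.tmul e 1 * z‖ := norm_add_le _ _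
      _ ≤ 1 * ‖hD.tmul 1 y - z‖ + ‖y‖ / 4 := by
          gcongr
          exact (norm_mul_le _ _).trans (by gcongr)
      _ < ‖y‖ := by linarith
  have h3 : ‖e‖ < 1 := by
    by_contra! h
    nlinarith
  obtain ⟨v, hv⟩ := isUnit_one_sub_of_norm_lt_one h3
  have := hl (↑v⁻¹) _ heK
  rwa [← hv, Units.inv_mul] at this

end Simple

section CrossNorm

variable {D R : Type*} [CStarAlgebra D] [CStarAlgebra R]

/-- For `y` positive of norm one and `s < 1` there is a nonzero function of `y` supported on
`[s, 1]`, hence divisible by all powers of `y` with control on the quotients. -/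
lemma exists_ne_zero_eq_pow_mul [Nontrivial D] [PartialOrder D] [StarOrderedRing D] {y : D}
    (h0 : 0 ≤ y) (hy1 : ‖y‖ = 1) {s : ℝ} (hs0 : 0 < s) (hs1 : s < 1) :
    ∃ z : D, z ≠ 0 ∧ ∀ n : ℕ, ∃ g : D, z = y ^ n * g ∧ ‖g‖ ≤ (s⁻¹) ^ n := by
  have hsa : IsSelfAdjoint y := IsSelfAdjoint.of_nonneg h0
  have hsp : ∀ t ∈ spectrum ℝ y, 0 ≤ t ∧ t ≤ 1 := fun t ht =>
    ⟨spectrum_nonneg_of_nonneg h0 ht, by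
      have := spectrum.norm_le_norm_of_mem ht
      rw [hy1] at this
      exact (le_abs_self t).trans this⟩
  have hcf : Continuous (fun t : ℝ => max (t - s) 0) := by fun_prop
  have hmax : ∀ t : ℝ, 0 < max t s := fun t => lt_max_of_lt_right hs0
  have hcg : ∀ n : ℕ, Continuous (fun t : ℝ => max (t - s) 0 / max t s ^ n) := fun n =>
    hcf.div (by fun_prop) fun t => (pow_pos (hmax t) n).ne'
  refine ⟨cfc (fun t : ℝ => max (t - s) 0) y, fun hz => ?_, fun n =>
    ⟨cfc (fun t : ℝ => max (t - s) 0 / max t s ^ n) y, ?_, ?_⟩⟩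
  · have h1 : (1 : ℝ) ∈ spectrum ℝ y := hy1 ▸ CStarAlgebra.norm_mem_spectrum_of_nonneg h0
    have h2 := cfc_map_spectrum (fun t : ℝ => max (t - s) 0) y hsa hcf.continuousOn
    rw [hz, spectrum.zero_eq] at h2
    have h3 : max (1 - s) 0 ∈ ({0} : Set ℝ) := h2 ▸ ⟨1, h1, rfl⟩
    rw [Set.mem_singleton_iff, max_eq_left (by linarith)] at h3
    linarith
  · rw [← cfc_pow_id (R := ℝ) y n hsa, ← cfc_mul (fun t : ℝ => t ^ n) _ y
      (continuous_pow n).continuousOn (hcg n).continuousOn]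
    refine cfc_congr fun t ht => ?_
    rcases le_total t s with hts | hts
    · simp [max_eq_right (sub_nonpos.2 hts)]
    · have : 0 < t := hs0.trans_le hts
      rw [max_eq_left hts]
      field_simp
  · refine norm_cfc_le (by positivity) fun t ht => ?_
    have hm := hmax t
    have h2 := hsp t ht
    rw [Real.norm_of_nonneg (by positivity), inv_pow, ← one_div]
    have h3 : max (t - s) 0 ≤ 1 := max_le (by linarith) zero_le_one
    have h4 : s ^ n ≤ max t s ^ n := by gcongr; exact le_max_right _ _
    gcongr

/-- Elements commuting with the image of a simple algebra satisfy the cross norm identity. -/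
lemma norm_mul_of_commute_of_simple
    (hsimple : ∀ K : AddSubgroup D, (∀ a, ∀ x ∈ K, a * x ∈ K) → (∀ a, ∀ x ∈ K, x * a ∈ K) →
      ∀ y ∈ K, y ≠ 0 → 1 ∈ K)
    (k : D →⋆ₐ[ℂ] R) {w : R} (hw : ∀ y, w * k y = k y * w) (y : D) :
    ‖w * k y‖ = ‖w‖ * ‖y‖ := by
  have hky : ‖k y‖ ≤ ‖y‖ := NonUnitalStarAlgHom.norm_apply_le k y
  refine le_antisymm ((norm_mul_le _ _).trans (by gcongr)) ?_
  rcases eq_or_ne w 0 with rfl | hw0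
  · simp
  rcases eq_or_ne y 0 with rfl | hy0
  · simp
  have : Nontrivial D := ⟨y, 0, hy0⟩
  let := CStarAlgebra.spectralOrder D
  have := CStarAlgebra.spectralOrderedRing D
  have hwn : 0 < ‖w‖ := norm_pos_iff.2 hw0
  have hyn : 0 < ‖y‖ := norm_pos_iff.2 hy0
  have hw' : ∀ y, star w * k y = k y * star w := fun y => by
    have := congrArg star (hw (star y))
    simpa [map_star] using this.symm
  set cw : ℂ := (((‖w‖ ^ 2)⁻¹ : ℝ) : ℂ)
  set cy : ℂ := (((‖y‖ ^ 2)⁻¹ : ℝ) : ℂ)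
  have hcw : ‖cw‖ = (‖w‖ ^ 2)⁻¹ := by simp [cw]
  have hcy : ‖cy‖ = (‖y‖ ^ 2)⁻¹ := by simp [cy]
  set P : R := cw • (star w * w) with hP
  set Y : D := cy • (star y * y) with hY
  have hPn : ‖P‖ = 1 := by
    rw [hP, norm_smul, CStarRing.norm_star_mul_self, hcw]; field_simp
  have hYn : ‖Y‖ = 1 := by
    rw [hY, norm_smul, CStarRing.norm_star_mul_self, hcy]; field_simp
  have hPsa : IsSelfAdjoint P := by
    rw [hP, IsSelfAdjoint, star_smul]; simp [cw]
  have hY0 : 0 ≤ Y := by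
    have : Y = star ((((‖y‖)⁻¹ : ℝ) : ℂ) • y) * ((((‖y‖)⁻¹ : ℝ) : ℂ) • y) := by
      rw [hY, star_smul, smul_mul_smul_comm]; simp [cy, sq]
    rw [this]
    exact star_mul_self_nonneg _
  have hPk : ∀ y, P * k y = k y * P := fun y => by
    simp [hP, mul_assoc, hw]
    simp [← mul_assoc, hw']
  have hPk' : ∀ (n : ℕ) y, P ^ n * k y = k y * P ^ n := fun n y =>
    (Commute.pow_left (show Commute P (k y) from hPk y) n)
  have key : 1 ≤ ‖P * k Y‖ := by
    by_contra! hlt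
    obtain ⟨s, hs, hs1⟩ := exists_between hlt
    have hs0 : 0 < s := (norm_nonneg _).trans_lt hs
    obtain ⟨z, hz0, hz⟩ := exists_ne_zero_eq_pow_mul hY0 hYn hs0 hs1
    let K : AddSubgroup D :=
      { carrier := {x | Tendsto (fun n : ℕ => P ^ n * k x) atTop (𝓝 0)}
        add_mem' := fun {a b} ha hb => by simpa [mul_add] using Tendsto.add ha hb
        zero_mem' := by simp
        neg_mem' := fun {a} ha => by simpa using Tendsto.neg ha }
    have hK1 : (1 : D) ∈ K := by
      refine hsimple K (fun a x hx => ?_) (fun a x hx => ?_) z ?_ hz0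
      · have := Tendsto.const_mul (k a) hx
        rw [mul_zero] at this
        refine this.congr fun n => ?_
        rw [map_mul, ← mul_assoc, ← mul_assoc, hPk']
      · have := Tendsto.mul_const (k a) hx
        rw [zero_mul] at this
        refine this.congr fun n => ?_
        rw [map_mul, mul_assoc]
      · change Tendsto _ _ _
        refine squeeze_zero_norm (a := fun n : ℕ => (‖P * k Y‖ / s) ^ n) (fun n => ?_)
          (tendsto_pow_atTop_nhds_zero_of_lt_one (by positivity) ((div_lt_one hs0).2 hs))
        obtain ⟨g, hg, hgn⟩ := hz n
        have h1 : P ^ n * k z = (P * k Y) ^ n * k g := by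
          rw [hg, map_mul, map_pow, (show Commute P (k Y) from hPk Y).mul_pow, mul_assoc]
        have h2 : ‖k g‖ ≤ ‖g‖ := NonUnitalStarAlgHom.norm_apply_le k g
        have : Nontrivial R := ⟨w, 0, hw0⟩
        calc ‖P ^ n * k z‖ ≤ ‖(P * k Y) ^ n‖ * ‖k g‖ := by rw [h1]; exact norm_mul_le _ _
          _ ≤ ‖P * k Y‖ ^ n * (s⁻¹) ^ n := by
              gcongr
              · exact norm_pow_le _ _
              · exact h2.trans hgn
          _ = _ := by rw [← mul_pow, div_eq_mul_inv]
    have h1 : Tendsto (fun n : ℕ => ‖P ^ (2 ^ n)‖) atTop (𝓝 0) := by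
      have h2 : Tendsto (fun n : ℕ => P ^ n * k 1) atTop (𝓝 0) := hK1
      have h3 := (h2.comp (tendsto_pow_atTop_atTop_of_one_lt (by norm_num : 1 < 2))).norm
      simpa [Function.comp_def] using h3
    have h2 : (fun n : ℕ => ‖P ^ (2 ^ n)‖) = fun _ => 1 := by
      ext n
      rw [hPsa.norm_pow_two_pow, hPn, one_pow]
    rw [h2] at h1
    exact zero_ne_one (tendsto_nhds_unique h1 tendsto_const_nhds)
  have h1 : P * k Y = (cw * cy) • (star (w * k y) * (w * k y)) := by
    rw [hP, hY, map_smul, smul_mul_smul_comm, star_mul, map_mul, map_star]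
    congr 1
    have h2 : star (k y) * star w = star w * star (k y) := by
      rw [← map_star, ← hw']
    have h3 : w * star (k y) = star (k y) * w := by rw [← map_star, hw]
    rw [h2]
    simp only [mul_assoc]
    rw [← mul_assoc w, h3, mul_assoc]
  rw [h1, norm_smul, norm_mul, hcw, hcy, CStarRing.norm_star_mul_self, ← sq] at key
  rw [← mul_inv, ← mul_pow, inv_mul_eq_div, one_le_div (by positivity)] at key
  exact (sq_le_sq₀ (by positivity) (norm_nonneg _)).1 key

end CrossNorm

section Multipliers

lemma coeHom_mul {E : Type*} [NonUnitalCStarAlgebra E] (m : 𝓜(ℂ, E)) (w : E) :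
    m * DoubleCentralizer.coeHom (𝕜 := ℂ) w = DoubleCentralizer.coeHom (𝕜 := ℂ) (m.fst w) := by
  refine DoubleCentralizer.ext _ _ _ _ (Prod.ext ?_ ?_)
  · ext t
    change m.fst (w * t) = m.fst w * t
    refine sub_eq_zero.1 ((CStarRing.star_mul_self_eq_zero_iff _).1 ?_)
    set c := star (m.fst (w * t) - m.fst w * t)
    rw [mul_sub, ← mul_assoc, ← m.central, ← m.central, mul_assoc, sub_self]
  · ext t
    exact m.central t w

lemma mul_coeHom {E : Type*} [NonUnitalCStarAlgebra E] (m : 𝓜(ℂ, E)) (w : E) :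
    DoubleCentralizer.coeHom (𝕜 := ℂ) w * m = DoubleCentralizer.coeHom (𝕜 := ℂ) (m.snd w) := by
  refine DoubleCentralizer.ext _ _ _ _ (Prod.ext ?_ ?_)
  · ext t
    exact (m.central w t).symm
  · ext t
    change m.snd (t * w) = t * m.snd w
    refine sub_eq_zero.1 ((CStarRing.mul_star_self_eq_zero_iff _).1 ?_)
    set c := star (m.snd (t * w) - t * m.snd w)
    rw [sub_mul, mul_assoc, m.central, m.central, mul_assoc, sub_self]

variable {A D E : Type*} [NonUnitalCStarAlgebra A] [CStarAlgebra D] [NonUnitalCStarAlgebra E]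

lemma CStarTensor.multiplier_ext (h : CStarTensor A D E) {m m' : 𝓜(ℂ, E)}
    (H : ∀ a d, m.fst (h.tmul a d) = m'.fst (h.tmul a d)) : m = m' := by
  rw [← sub_eq_zero, ← norm_eq_zero, ← DoubleCentralizer.norm_fst, norm_eq_zero,
    DoubleCentralizer.sub_fst, sub_eq_zero]
  exact ContinuousLinearMap.ext_on h.dense_span (by rintro _ ⟨a, b, rfl⟩; exact H a b)

/-- The second factor acts by multipliers on a tensor product. -/
lemma CStarTensor.exists_multiplier (h : CStarTensor A D E) (d : D) :
    ∃ m : 𝓜(ℂ, E), ∀ a x, m.fst (h.tmul a x) = h.tmul a (d * x) ∧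
      m.snd (h.tmul a x) = h.tmul a (x * d) := by
  let := CStarAlgebra.spectralOrder A
  have := CStarAlgebra.spectralOrderedRing A
  set l := CStarAlgebra.approximateUnit A
  have hl : l.IsIncreasingApproximateUnit := CStarAlgebra.increasingApproximateUnit A
  have : l.NeBot := hl.neBot
  have hbd : ∀ᶠ g in l, ‖h.tmul g d‖ ≤ ‖d‖ := hl.eventually_norm.mono fun g hg => by
    rw [h.norm_tmul]
    exact mul_le_of_le_one_left (norm_nonneg _) hg
  obtain ⟨L, hL⟩ := exists_limit_of_dense_span (l := l) h.dense_span
    (fun g => (ContinuousLinearMap.mul ℂ E (h.tmul g d) : E →ₗ[ℂ] E)) ‖d‖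
    (hbd.mono fun g hg w => (norm_mul_le _ _).trans (by gcongr)) (by
      rintro _ ⟨a, x, rfl⟩
      refine ⟨h.tmul a (d * x), ?_⟩
      have := (h.continuous_tmul.tendsto (a, d * x)).comp
        ((hl.tendsto_mul_right a).prodMk_nhds tendsto_const_nhds)
      refine this.congr fun g => ?_
      exact (h.mul_tmul g a d x).symm)
  obtain ⟨S, hS⟩ := exists_limit_of_dense_span (l := l) h.dense_span
    (fun g => ((ContinuousLinearMap.mul ℂ E).flip (h.tmul g d) : E →ₗ[ℂ] E)) ‖d‖
    (hbd.mono fun g hg w => (norm_mul_le _ _).trans (by rw [mul_comm]; gcongr)) (by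
      rintro _ ⟨a, x, rfl⟩
      refine ⟨h.tmul a (x * d), ?_⟩
      have := (h.continuous_tmul.tendsto (a, x * d)).comp
        ((hl.tendsto_mul_left a).prodMk_nhds tendsto_const_nhds)
      refine this.congr fun g => ?_
      exact (h.mul_tmul a g x d).symm)
  replace hL : ∀ w, Tendsto (fun g => h.tmul g d * w) l (𝓝 (L w)) := hL
  replace hS : ∀ w, Tendsto (fun g => w * h.tmul g d) l (𝓝 (S w)) := hS
  refine ⟨⟨(L, S), fun x y => ?_⟩, fun a x => ⟨?_, ?_⟩⟩
  · refine tendsto_nhds_unique ((hS x).mul_const y) ?_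
    simpa [mul_assoc] using (hL y).const_mul x
  · refine tendsto_nhds_unique (hL (h.tmul a x)) ?_
    have := (h.continuous_tmul.tendsto (a, d * x)).comp
      ((hl.tendsto_mul_right a).prodMk_nhds tendsto_const_nhds)
    exact this.congr fun g => (h.mul_tmul g a d x).symm
  · refine tendsto_nhds_unique (hS (h.tmul a x)) ?_
    have := (h.continuous_tmul.tendsto (a, x * d)).comp
      ((hl.tendsto_mul_left a).prodMk_nhds tendsto_const_nhds)
    exact this.congr fun g => (h.mul_tmul a g x d).symm

/-- The second factor of a tensor product embeds unitally in the multiplier algebra. -/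
lemma CStarTensor.exists_multiplier_hom (h : CStarTensor A D E) :
    ∃ j : D →⋆ₐ[ℂ] 𝓜(ℂ, E), ∀ a x d,
      j d * DoubleCentralizer.coeHom (𝕜 := ℂ) (h.tmul a x)
          = DoubleCentralizer.coeHom (𝕜 := ℂ) (h.tmul a (d * x)) ∧
        DoubleCentralizer.coeHom (𝕜 := ℂ) (h.tmul a x) * j d
          = DoubleCentralizer.coeHom (𝕜 := ℂ) (h.tmul a (x * d)) := by
  choose j hj using h.exists_multiplier
  have hj1 : ∀ d a x, (j d).fst (h.tmul a x) = h.tmul a (d * x) := fun d a x => (hj d a x).1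
  have hj2 : ∀ d a x, (j d).snd (h.tmul a x) = h.tmul a (x * d) := fun d a x => (hj d a x).2
  let J : D →⋆ₙₐ[ℂ] 𝓜(ℂ, E) :=
    { toFun := j
      map_smul' := fun c d => h.multiplier_ext fun a x => by
        simp [hj1, h.smul_right]
      map_zero' := h.multiplier_ext fun a x => by simp [hj1, h.zero_right]
      map_add' := fun d d' => h.multiplier_ext fun a x => by
        simp [hj1, add_mul, h.add_right]
      map_mul' := fun d d' => h.multiplier_ext fun a x => by
        simp [hj1, mul_assoc]
      map_star' := fun d => h.multiplier_ext fun a x => by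
        simp [hj1, hj2, h.star_tmul] }
  have hJ : ∀ d, J d = j d := fun d => rfl
  refine ⟨J.toUnital (h.multiplier_ext fun a x => by simp [hJ, hj1]), fun a x d => ⟨?_, ?_⟩⟩
  · rw [coeHom_mul]
    exact congrArg _ (hj1 d a x)
  · rw [mul_coeHom]
    exact congrArg _ (hj2 d a x)

end Multipliers

section Hereditary

lemma cStarNonneg_iff {A : Type*} [NonUnitalCStarAlgebra A] [PartialOrder A] [StarOrderedRing A]
    {a : A} : CStarNonneg a ↔ 0 ≤ a :=
  CStarAlgebra.nonneg_iff_eq_star_mul_self.symm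

lemma star_mul_eq_polarization {R : Type*} [CStarAlgebra R] (p q : R) :
    star q * p = (4 : ℂ)⁻¹ • ∑ k : Fin 4, (Complex.I ^ (k : ℕ)) •
      (star (p + Complex.I ^ (k : ℕ) • q) * (p + Complex.I ^ (k : ℕ) • q)) := by
  rw [eq_inv_smul_iff₀ (by norm_num)]
  have h3 : Complex.I ^ 3 = -Complex.I := by
    rw [pow_succ, Complex.I_sq]; ring
  simp only [Fin.sum_univ_four, Fin.val_zero, Fin.val_one, Fin.val_two, pow_zero, pow_one,
    Complex.I_sq, show ((3 : Fin 4) : ℕ) = 3 from rfl, h3, star_add, star_smul, mul_add, add_mul,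
    smul_add, one_smul, smul_mul_assoc, mul_smul_comm, smul_smul, neg_smul, map_one,
    map_neg, mul_one, neg_mul, mul_neg, neg_neg, Complex.star_def, Complex.conj_I,
    Complex.I_mul_I]
  have : (4 : ℂ) • (star q * p) = star q * p + star q * p + star q * p + star q * p := by
    rw [show (4 : ℂ) = 1 + 1 + 1 + 1 by norm_num]
    simp only [add_smul, one_smul]
  rw [this]
  abel

/-- A hereditary subalgebra is closed under two-sided compression of multipliers. -/
lemma exists_mul_mul_eq_of_hereditary {A B R : Type*} [NonUnitalCStarAlgebra A]
    [NonUnitalCStarAlgebra B] [CStarAlgebra R] (β : B →⋆ₙₐ[ℂ] A)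
    (hher : ∀ a ∈ Set.range β, CStarNonneg a →
      ∀ b : A, CStarNonneg b → CStarNonneg (a - b) → b ∈ Set.range β)
    (i : A →⋆ₙₐ[ℂ] R) (hi : Function.Injective i) (hideal : ∀ (m : R) (a : A), ∃ a', m * i a = i a')
    (m : R) (b b' : B) : ∃ b'', i (β b) * m * i (β b') = i (β b'') := by
  let := CStarAlgebra.spectralOrder A
  have := CStarAlgebra.spectralOrderedRing A
  let := CStarAlgebra.spectralOrder R
  have := CStarAlgebra.spectralOrderedRing R
  set p : A := β b'
  obtain ⟨q, hq⟩ := hideal (star m) (β (star b))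
  have key : ∀ c : ℂ, ‖c‖ = 1 → star (p + c • q) * (p + c • q) ∈ Set.range β := by
    intro c hc
    have hcc : star c * c = 1 := by
      rw [Complex.star_def, ← Complex.normSq_eq_conj_mul_self, Complex.normSq_eq_norm_sq, hc]; simp
    have h1 : star (p + c • q) * (p + c • q) ≤ (2 : ℂ) • (star p * p) + (2 : ℂ) • (star q * q) := by
      rw [← sub_nonneg]
      have : (2 : ℂ) • (star p * p) + (2 : ℂ) • (star q * q) - star (p + c • q) * (p + c • q)
          = star (p - c • q) * (p - c • q) := by
        have hqq : star (c • q) * (c • q) = star q * q := by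
          rw [star_smul, smul_mul_smul_comm, hcc, one_smul]
        simp only [star_add, star_sub, mul_add, add_mul, mul_sub, sub_mul, hqq, two_smul]
        abel
      rw [this]
      exact star_mul_self_nonneg _
    have h2 : star q * q ≤ ((‖m‖ ^ 2 : ℝ) : ℂ) • (β b * star (β b)) := by
      have h3 : 0 ≤ algebraMap ℝ R (‖m‖ ^ 2) - m * star m := by
        rw [sub_nonneg, sq, ← CStarRing.norm_self_mul_star]
        exact IsSelfAdjoint.le_algebraMap_norm_self (IsSelfAdjoint.mul_star_self m)
      obtain ⟨s, hs⟩ := CStarAlgebra.nonneg_iff_eq_star_mul_self.1 h3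
      obtain ⟨t, ht⟩ := hideal s (β (star b))
      have h4 : ((‖m‖ ^ 2 : ℝ) : ℂ) • (β b * star (β b)) - star q * q = star t * t := by
        apply hi
        rw [map_sub, map_mul, map_star, map_mul, map_star, map_smul, map_mul, map_star, ← hq, ← ht,
          star_mul, star_mul, star_star, map_star, map_star, star_star]
        have h5 : i (β b) * star s * (s * star (i (β b))) = i (β b) * (star s * s) * star (i (β b)) := by
          simp only [mul_assoc]
        rw [h5, ← hs, mul_sub, sub_mul, Algebra.algebraMap_eq_smul_one, mul_smul_comm, mul_one,
          smul_mul_assoc]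
        congr 1
        simp only [mul_assoc]
      rw [← sub_nonneg, h4]
      exact star_mul_self_nonneg _
    set y : B := (2 : ℂ) • (star b' * b') + (2 : ℂ) • ((‖m‖ ^ 2 : ℝ) : ℂ) • (b * star b) with hy
    have hβy : β y = (2 : ℂ) • (star p * p) +
        (2 : ℂ) • ((‖m‖ ^ 2 : ℝ) : ℂ) • (β b * star (β b)) := by
      simp [hy, p, map_star]
    have h6 : star (p + c • q) * (p + c • q) ≤ β y := by
      rw [hβy]
      refine h1.trans ?_
      simp only [two_smul]
      gcongr
    have h0 : 0 ≤ star (p + c • q) * (p + c • q) := star_mul_self_nonneg _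
    exact hher (β y) ⟨y, rfl⟩ (cStarNonneg_iff.2 (h0.trans h6)) _ (cStarNonneg_iff.2 h0)
      (cStarNonneg_iff.2 (sub_nonneg.2 h6))
  choose f hf using fun k : Fin 4 => key (Complex.I ^ (k : ℕ)) (by simp)
  refine ⟨(4 : ℂ)⁻¹ • ∑ k : Fin 4, (Complex.I ^ (k : ℕ)) • f k, ?_⟩
  have h1 : i (β b) * m = star (i q) := by
    rw [← hq, star_mul, star_star, map_star, map_star, star_star]
  have h2 : i (β b') = i p := rfl
  rw [h1, h2, star_mul_eq_polarization]
  simp only [map_smul, map_sum, hf, map_mul, map_star, map_add]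

end Hereditary

section Twist

lemma AU.exists_asymptotically_central {D : Type*} [CStarAlgebra D] {κ κ' : D → D}
    (h1 : AU (fun d => d) κ) (h2 : AU (fun d => d) κ')
    (hcomm : ∀ x y, κ x * κ' y = κ' y * κ x) :
    ∃ l : Filter (unitary D), l.NeBot ∧ ∀ x y : D,
      Tendsto (fun W : unitary D => (W : D) * x * star (W : D) * y - y * (W * x * star (W : D)))
        l (𝓝 0) := by
  obtain ⟨l₁, hl₁, h1⟩ := h1
  obtain ⟨l₂, hl₂, h2⟩ := h2
  refine ⟨(l₁ ×ˢ l₂).map fun p => star p.2 * p.1, inferInstance, fun x y => tendsto_map'_iff.2 ?_⟩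
  have hx := (h1 x).comp (tendsto_fst (f := l₁) (g := l₂))
  have hy := (h2 y).comp (tendsto_snd (f := l₁) (g := l₂))
  have := (hx.mul hy).sub (hy.mul hx)
  rw [hcomm, sub_self, tendsto_zero_iff_norm_tendsto_zero] at this
  rw [tendsto_zero_iff_norm_tendsto_zero]
  refine this.congr fun p => ?_
  obtain ⟨V, V'⟩ := p
  rw [← CStarRing.norm_mul_coe_unitary _ V', ← CStarRing.norm_coe_unitary_mul (star V')]
  congr 1
  have h0 : ∀ z : D, star (V' : D) * (V' * z) = z := fun z => by
    rw [← mul_assoc, Unitary.coe_star_mul_self, one_mul]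
  have h0' : star (V' : D) * V' = 1 := Unitary.coe_star_mul_self V'
  simp only [Function.comp_apply, Unitary.coe_star, Submonoid.coe_mul, star_mul, star_star, mul_sub,
    sub_mul, mul_assoc, h0, h0', mul_one]

variable {A D R : Type*} [NonUnitalCStarAlgebra A] [CStarAlgebra D] [CStarAlgebra R]

lemma exists_twist (i : A →⋆ₙₐ[ℂ] R) (hi : Function.Injective i) (j : D →⋆ₐ[ℂ] R)
    (hS : Dense ((Submodule.span ℂ {a | ∃ t d, (∀ d', t * j d' = j d' * t) ∧ i a = t * j d} :
      Submodule ℂ A) : Set A))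
    {κ : D → D} (hκ : AU (fun d => d) κ) :
    ∃ k : A →⋆ₙₐ[ℂ] R, (∀ a, ‖k a‖ = ‖a‖) ∧
      (∀ t d a, (∀ d', t * j d' = j d' * t) → i a = t * j d → k a = t * j (κ d)) ∧
      ∀ a d a' a'', i a * j d * i a' = i a'' → k a * j (κ d) * k a' = k a'' := by
  obtain ⟨l, hl, hκ⟩ := hκ
  have hVj : ∀ V : unitary D, star (j V) * j V = 1 := fun V => by
    rw [← map_star, ← map_mul, Unitary.coe_star_mul_self, map_one]
  have hVj' : ∀ (V : unitary D) z, star (j V) * (j V * z) = z := fun V z => by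
    rw [← mul_assoc, hVj, one_mul]
  let T : unitary D → A →⋆ₙₐ[ℂ] R := fun V =>
    { toFun := fun a => j V * i a * star (j V)
      map_smul' := fun c a => by simp
      map_zero' := by simp
      map_add' := fun a b => by simp [mul_add, add_mul]
      map_mul' := fun a b => by simp only [map_mul, mul_assoc, hVj']
      map_star' := fun a => by simp [mul_assoc, map_star] }
  have hTa : ∀ V a, T V a = j V * i a * star (j V) := fun _ _ => rfl
  have hT : ∀ V a, ‖T V a‖ = ‖a‖ := fun V a => by
    refine NonUnitalStarAlgHom.norm_map (T V) (fun a b hab => hi ?_) a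
    have : star (j V) * T V a * j V = star (j V) * T V b * j V := by rw [hab]
    simpa only [hTa, mul_assoc, hVj, hVj', mul_one] using this
  have hlim : ∀ t d a, (∀ d', t * j d' = j d' * t) → i a = t * j d →
      Tendsto (fun V => T V a) l (𝓝 (t * j (κ d))) := fun t d a ht ha => by
    have h1 : ∀ V : unitary D, t * j ((V : D) * d * star (V : D)) = T V a := fun V => by
      rw [hTa, ha, map_mul, map_mul, map_star, ← mul_assoc, ← mul_assoc, ht]
      simp only [mul_assoc]
    exact ((((map_continuous j).tendsto _).comp (hκ d)).const_mul t).congr h1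
  obtain ⟨k, hk, hk'⟩ := exists_starHom_limit hS T hT
    fun a ⟨t, d, ht, ha⟩ => ⟨_, hlim t d a ht ha⟩
  refine ⟨k, hk', fun t d a ht ha => tendsto_nhds_unique (hk a) (hlim t d a ht ha),
    fun a d a' a'' h => tendsto_nhds_unique ?_ (hk a'')⟩
  have h1 := ((map_continuous j).tendsto _).comp (hκ d)
  refine (((hk a).mul h1).mul (hk a')).congr fun V => ?_
  simp only [Function.comp_apply, map_mul, map_star, hTa, ← h, mul_assoc, hVj']

end Twist

section Setup

variable {A B D TD AD : Type u} [NonUnitalCStarAlgebra A] [NonUnitalCStarAlgebra B]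
  [CStarAlgebra D] [CStarAlgebra TD] [NonUnitalCStarAlgebra AD]

lemma exists_hereditary_representation (hD : MinTensor D D TD) (φ : D ≃⋆ₐ[ℂ] TD)
    (h1 : AU (fun d : D => d) (fun d => φ.symm (hD.tmul d 1)))
    (h2 : AU (fun d : D => d) (fun d => φ.symm (hD.tmul 1 d)))
    (hAD : CStarTensor A D AD) (α : AD ≃⋆ₐ[ℂ] A) (β : B →⋆ₙₐ[ℂ] A) (hβ : Function.Injective β)
    (hher : ∀ a ∈ Set.range β, CStarNonneg a →
      ∀ b : A, CStarNonneg b → CStarNonneg (a - b) → b ∈ Set.range β) :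
    ∃ (R : Type u) (_ : CStarAlgebra R) (k : B →⋆ₙₐ[ℂ] R) (Φ : TD →⋆ₐ[ℂ] R)
      (l : Filter (unitary D)), l.NeBot ∧ (∀ b, ‖k b‖ = ‖b‖) ∧
      (∀ b y, k b * Φ (hD.tmul 1 y) = Φ (hD.tmul 1 y) * k b) ∧
      (∀ b x b', ∃ b'', k b * Φ (hD.tmul x 1) * k b' = k b'') ∧
      ∀ b x, Tendsto (fun W : unitary D => Φ (hD.tmul (W * x * star (W : D)) 1) * k b -
        k b * Φ (hD.tmul (W * x * star (W : D)) 1)) l (𝓝 0) := by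
  obtain ⟨j, hj⟩ := hAD.exists_multiplier_hom
  have hcomm : ∀ x y, φ.symm (hD.tmul x 1) * φ.symm (hD.tmul 1 y)
      = φ.symm (hD.tmul 1 y) * φ.symm (hD.tmul x 1) := fun x y => by
    rw [← map_mul, ← map_mul, hD.mul_tmul, hD.mul_tmul]
    simp
  obtain ⟨l, hl, hW⟩ := h1.exists_asymptotically_central h2 hcomm
  let ρ := DoubleCentralizer.coeHom (𝕜 := ℂ) (A := AD)
  let αs : A →⋆ₙₐ[ℂ] AD := α.symm
  let i : A →⋆ₙₐ[ℂ] 𝓜(ℂ, AD) := ρ.comp αs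
  have hia : ∀ a, i a = ρ (α.symm a) := fun _ => rfl
  have hi : Function.Injective i := coeHom_injective.comp (EquivLike.injective α.symm)
  have hρj : ∀ a d, ρ (hAD.tmul a d) = ρ (hAD.tmul a 1) * j d := fun a d => by
    rw [(hj a 1 d).2, one_mul]
  have hρc : ∀ a d, ρ (hAD.tmul a 1) * j d = j d * ρ (hAD.tmul a 1) := fun a d => by
    rw [(hj a 1 d).2, (hj a 1 d).1, one_mul, mul_one]
  have hS : Dense ((Submodule.span ℂ {a | ∃ t d, (∀ d', t * j d' = j d' * t) ∧ i a = t * j d} :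
      Submodule ℂ A) : Set A) := by
    let L : AD →ₗ[ℂ] A := { toFun := α, map_add' := map_add α, map_smul' := map_smul α }
    have hα : Continuous α := map_continuous (α : AD →⋆ₙₐ[ℂ] A)
    refine ((EquivLike.surjective α).denseRange.dense_image hα hAD.dense_span).mono ?_
    have : α '' (Submodule.span ℂ {t | ∃ a b, hAD.tmul a b = t} : Submodule ℂ AD)
        = ((Submodule.span ℂ {t | ∃ a b, hAD.tmul a b = t}).map L : Submodule ℂ A) := rfl
    rw [this, Submodule.map_span]
    refine Submodule.span_mono ?_
    rintro _ ⟨_, ⟨a, d, rfl⟩, rfl⟩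
    refine ⟨ρ (hAD.tmul a 1), d, hρc a, ?_⟩
    change ρ (α.symm (α _)) = _
    rw [StarAlgEquiv.symm_apply_apply, hρj]
  have hideal : ∀ (m : 𝓜(ℂ, AD)) (a : A), ∃ a', m * i a = i a' := fun m a =>
    ⟨α (m.fst (α.symm a)), by rw [hia, hia, StarAlgEquiv.symm_apply_apply]; exact coeHom_mul m _⟩
  obtain ⟨kh, hkh, hkh1, hkh2⟩ := exists_twist i hi j hS h1
  let φs : TD →⋆ₐ[ℂ] D := φ.symm
  have hΦ : ∀ z, (j.comp φs) z = j (φ.symm z) := fun _ => rfl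
  refine ⟨𝓜(ℂ, AD), inferInstance, kh.comp β, j.comp φs, l, hl, fun b => ?_, fun b y => ?_,
    fun b x b' => ?_, fun b x => ?_⟩
  · rw [NonUnitalStarAlgHom.comp_apply, hkh, NonUnitalStarAlgHom.norm_map β hβ]
  · rw [NonUnitalStarAlgHom.comp_apply, hΦ]
    refine sub_eq_zero.1 ?_
    let T : A →ₗ[ℂ] 𝓜(ℂ, AD) :=
      { toFun := fun a => kh a * j (φ.symm (hD.tmul 1 y)) - j (φ.symm (hD.tmul 1 y)) * kh a
        map_add' := fun a b => by simp [mul_add, add_mul]; abel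
        map_smul' := fun c a => by simp [smul_sub] }
    refine tendsto_nhds_unique (tendsto_const_nhds (f := (⊤ : Filter Unit))) (tendsto_zero_of_dense_span
      hS (fun _ : Unit => T) (2 * ‖j (φ.symm (hD.tmul 1 y))‖) (Eventually.of_forall fun _ a => ?_)
      ?_ (β b))
    · refine (norm_sub_le _ _).trans ?_
      refine (add_le_add (norm_mul_le _ _) (norm_mul_le _ _)).trans_eq ?_
      rw [hkh]
      ring
    · rintro a ⟨t, d, ht, ha⟩
      have : T a = 0 := by
        change kh a * j (φ.symm (hD.tmul 1 y)) - j (φ.symm (hD.tmul 1 y)) * kh a = 0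
        rw [hkh1 t d a ht ha, ← mul_assoc, ← ht, mul_assoc, mul_assoc, ← map_mul j,
          ← map_mul j, hcomm, sub_self]
      simp [this]
  · obtain ⟨b'', hb⟩ := exists_mul_mul_eq_of_hereditary β hher i hi hideal (j x) b b'
    exact ⟨b'', hkh2 _ _ _ _ hb⟩
  · let T : unitary D → A →ₗ[ℂ] 𝓜(ℂ, AD) := fun W =>
      { toFun := fun a => j (φ.symm (hD.tmul (W * x * star (W : D)) 1)) * kh a -
          kh a * j (φ.symm (hD.tmul (W * x * star (W : D)) 1))
        map_add' := fun a b => by simp [mul_add, add_mul]; abel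
        map_smul' := fun c a => by simp [smul_sub] }
    refine tendsto_zero_of_dense_span hS T (2 * ‖x‖) (Eventually.of_forall fun W a => ?_) ?_ (β b)
    · have hx : ‖j (φ.symm (hD.tmul (W * x * star (W : D)) 1))‖ ≤ ‖x‖ := by
        refine (NonUnitalStarAlgHom.norm_apply_le j _).trans ?_
        rw [norm_starAlgEquiv_apply, hD.norm_tmul, ← Unitary.coe_star,
          CStarRing.norm_mul_coe_unitary, CStarRing.norm_coe_unitary_mul]
        refine mul_le_of_le_one_right (norm_nonneg _) ?_
        rcases subsingleton_or_nontrivial D with h | h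
        · simp [Subsingleton.elim (1 : D) 0]
        · exact (CStarRing.norm_of_mem_unitary (one_mem _)).le
      refine (norm_sub_le _ _).trans ?_
      refine (add_le_add (norm_mul_le _ _) (norm_mul_le _ _)).trans ?_
      rw [hkh]
      nlinarith [norm_nonneg a]
    · rintro a ⟨t, d, ht, ha⟩
      have := ((map_continuous (hD.inl)).tendsto _).comp (hW x d)
      have := (((map_continuous (j.comp φs)).tendsto _).comp this).const_mul t
      rw [map_zero, map_zero, mul_zero] at this
      have hp : ∀ p : D, t * j (φ.symm (hD.inl (p * d - d * p))) =
          j (φ.symm (hD.inl p)) * (t * j (φ.symm (hD.inl d))) -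
            t * j (φ.symm (hD.inl d)) * j (φ.symm (hD.inl p)) := fun p => by
        rw [← mul_assoc, ← ht, mul_assoc, mul_assoc]
        simp only [map_sub, map_mul, mul_sub]
      refine this.congr fun W => (hp _).trans ?_
      change _ = j (φ.symm (hD.inl _)) * kh a - kh a * j (φ.symm (hD.inl _))
      rw [hkh1 t d a ht ha]
      rfl

end Setup

section KOne

lemma Joined.mul_mul_right_left {M : Type*} [TopologicalSpace M] [Mul M] [ContinuousMul M] {p q : M}
    (h : Joined p q) (a b : M) : Joined (a * p * b) (a * q * b) := by
  obtain ⟨γ⟩ := h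
  exact ⟨γ.map (f := fun x => a * x * b) (by fun_prop)⟩

variable {D : Type*} [CStarAlgebra D]

/-- Rotation of the first coordinate into the second. -/
def matrixRotation (D : Type*) [CStarAlgebra D] (t : ℝ) : unitary (Matrix (Fin 2) (Fin 2) D) :=
  ⟨!![algebraMap ℝ D (Real.cos t), -algebraMap ℝ D (Real.sin t);
      algebraMap ℝ D (Real.sin t), algebraMap ℝ D (Real.cos t)], by
    have h1 : algebraMap ℝ D (Real.cos t) * algebraMap ℝ D (Real.cos t) +
        algebraMap ℝ D (Real.sin t) * algebraMap ℝ D (Real.sin t) = 1 := by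
      rw [← map_mul, ← map_mul, ← map_add, ← sq, ← sq, Real.cos_sq_add_sin_sq, map_one]
    have h2 := Algebra.commutes (Real.cos t) (algebraMap ℝ D (Real.sin t))
    have hs : ∀ r : ℝ, star (algebraMap ℝ D r) = algebraMap ℝ D r := fun r => by
      rw [← algebraMap_star_comm, star_trivial]
    have hT : star !![algebraMap ℝ D (Real.cos t), -algebraMap ℝ D (Real.sin t);
        algebraMap ℝ D (Real.sin t), algebraMap ℝ D (Real.cos t)] =
        !![algebraMap ℝ D (Real.cos t), algebraMap ℝ D (Real.sin t);
        -algebraMap ℝ D (Real.sin t), algebraMap ℝ D (Real.cos t)] := by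
      ext i j
      fin_cases i <;> fin_cases j <;> simp [Matrix.star_apply, hs]
    rw [Unitary.mem_iff, hT, Matrix.mul_fin_two, Matrix.mul_fin_two, Matrix.one_fin_two]
    simp only [mul_neg, neg_mul, neg_neg, h1, h2, add_comm (algebraMap ℝ D (Real.sin t) * _),
      neg_add_cancel, and_self]⟩

lemma continuous_matrixRotation : Continuous (matrixRotation D) := by
  refine Continuous.subtype_mk (continuous_matrix fun i j => ?_) _
  fin_cases i <;> fin_cases j <;> simp <;> fun_prop

lemma joined_matrixRotation (s t : ℝ) : Joined (matrixRotation D s) (matrixRotation D t) :=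
  ((isPathConnected_range continuous_matrixRotation).joinedIn _ ⟨s, rfl⟩ _ ⟨t, rfl⟩).joined

/-- Commutators of unitaries vanish in `K₁`. -/
lemma representsZeroInK1_commutator (u w : unitary D) :
    RepresentsZeroInK1 ((u * w * star u * star w : unitary D) : D) := by
  have hdiag : ∀ p q : unitary D, Matrix.diagonal ![(p : D), (q : D)] ∈
      unitary (Matrix (Fin 2) (Fin 2) D) := fun p q => by
    rw [Unitary.mem_iff, Matrix.star_eq_conjTranspose, Matrix.diagonal_conjTranspose,
      Matrix.diagonal_mul_diagonal, Matrix.diagonal_mul_diagonal, ← Matrix.diagonal_one]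
    constructor <;> congr 1 <;> ext i <;> fin_cases i <;> simp
  let dg : unitary D → unitary D → unitary (Matrix (Fin 2) (Fin 2) D) := fun p q => ⟨_, hdiag p q⟩
  have hdg : ∀ p q p' q', dg p q * dg p' q' = dg (p * p') (q * q') := fun p q p' q' => by
    refine Subtype.ext ?_
    change Matrix.diagonal _ * Matrix.diagonal _ = Matrix.diagonal _
    rw [Matrix.diagonal_mul_diagonal]
    congr 1
    ext i
    fin_cases i <;> simp
  have hdg1 : dg 1 1 = 1 := by
    refine Subtype.ext ?_
    change Matrix.diagonal _ = 1
    rw [← Matrix.diagonal_one]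
    congr 1
    ext i
    fin_cases i <;> simp
  have hrot : ∀ p q, matrixRotation D (Real.pi / 2) * dg p q = dg q p * matrixRotation D (Real.pi / 2) := by
    intro p q
    refine Subtype.ext ?_
    change (matrixRotation D (Real.pi / 2) : Matrix (Fin 2) (Fin 2) D) * Matrix.diagonal _
      = Matrix.diagonal _ * (matrixRotation D (Real.pi / 2) : Matrix (Fin 2) (Fin 2) D)
    ext i j
    fin_cases i <;> fin_cases j <;> simp [matrixRotation]
  have hrot0 : matrixRotation D 0 = 1 := by
    refine Subtype.ext ?_
    ext i j
    fin_cases i <;> fin_cases j <;> simp [matrixRotation]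
  have key : Joined (dg (star u) 1) (dg 1 (star u)) := by
    set r := matrixRotation D (Real.pi / 2)
    have h1 : Joined r 1 := hrot0 ▸ joined_matrixRotation (Real.pi / 2) 0
    have h2 : Joined (r * dg (star u) 1) (dg (star u) 1) := by
      simpa using h1.mul_mul_right_left 1 (dg (star u) 1)
    have h3 : Joined (dg 1 (star u) * r) (dg 1 (star u)) := by
      simpa using h1.mul_mul_right_left (dg 1 (star u)) 1
    exact h2.symm.trans (hrot _ _ ▸ h3)
  have h1 := key.mul_mul_right_left (dg u 1) 1
  have h2 := key.mul_mul_right_left (dg (u * w) 1) (dg (star w) 1)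
  simp only [hdg, mul_one, one_mul, Unitary.mul_star_self, hdg1, mul_assoc] at h1 h2
  have h3 : Joined (dg (u * w * star u * star w) 1) 1 := by
    simpa only [mul_assoc] using h2.trans h1.symm
  have h4 : ((dg (u * w * star u * star w) 1 : unitary (Matrix (Fin 2) (Fin 2) D)) :
      Matrix (Fin 2) (Fin 2) D) = stabUnitary 1 ((u * w * star u * star w : unitary D) : D) := by
    change Matrix.diagonal _ = Matrix.diagonal _
    congr 1
    ext i
    fin_cases i <;> simp
  refine ⟨1, h4 ▸ (dg (u * w * star u * star w) 1).2, ?_⟩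
  convert h3
  exact h4.symm

end KOne

section ExpFlip

variable {D TD : Type u} [CStarAlgebra D] [CStarAlgebra TD]

lemma K1Injective.joined_commutator (hK1 : K1Injective D) (φ : D ≃⋆ₐ[ℂ] TD) (u w : unitary TD) :
    Joined (u * w * star u * star w) 1 := by
  let φs : TD →⋆ₐ[ℂ] D := φ.symm
  let φh : D →⋆ₐ[ℂ] TD := φ
  let p : unitary TD → unitary D := fun v => ⟨φs v, Unitary.map_mem φs v.2⟩
  have h := hK1 _ (representsZeroInK1_commutator (p u) (p w))
  let f : unitary D → unitary TD := fun v => ⟨φh v, Unitary.map_mem φh v.2⟩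
  have hf : Continuous f := ((map_continuous φh).comp continuous_subtype_val).subtype_mk _
  obtain ⟨γ⟩ := h
  have hp : ∀ v : unitary TD, φ (φ.symm v) = v := fun v => φ.apply_symm_apply _
  have h1 : f (p u * p w * star (p u) * star (p w)) = u * w * star u * star w := by
    refine Subtype.ext ?_
    change φ (φ.symm u * φ.symm w * star (φ.symm (u : TD)) * star (φ.symm (w : TD))) =
      u * w * star (u : TD) * star (w : TD)
    simp only [map_mul, map_star, hp]
  have h2 : f 1 = 1 := Subtype.ext (map_one φh)
  exact ⟨(γ.map hf).cast h1.symm h2.symm⟩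

/-- In a `K₁`-injective strongly self-absorbing algebra the half flip is approximately
implemented by products of exponentials. -/
lemma exists_exp_flip (hD : MinTensor D D TD) (φ : D ≃⋆ₐ[ℂ] TD) (hK1 : K1Injective D)
    (hflip : AU (fun d : D => hD.tmul 1 d) fun d => hD.tmul d 1)
    (hκ : AU (fun d : D => d) (fun d => φ.symm (hD.tmul 1 d))) (F : Finset D) {ε : ℝ}
    (hε : 0 < ε) :
    ∃ L : List (selfAdjoint TD), ∀ y ∈ F,
      ‖star ((L.map selfAdjoint.expUnitary).prod : TD) * hD.tmul 1 y *
        ((L.map selfAdjoint.expUnitary).prod : TD) - hD.tmul y 1‖ < ε := by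
  obtain ⟨l, hl, h1⟩ := hflip
  have h2 : ∀ᶠ V : unitary TD in l, ∀ y ∈ F,
      ‖(V : TD) * hD.tmul 1 y * star (V : TD) - hD.tmul y 1‖ < ε := by
    rw [Filter.eventually_all_finset]
    intro y _
    have := (h1 y).eventually (Metric.ball_mem_nhds _ hε)
    simpa only [Metric.mem_ball, dist_eq_norm] using this
  obtain ⟨V, hV⟩ := h2.exists
  let φh : D →⋆ₐ[ℂ] TD := φ
  obtain ⟨l', hl', h3⟩ := (hκ.map φh).comp φ.symm
  have h4 := h3 (V : TD)
  change Tendsto (fun w : unitary TD => (w : TD) * φ (φ.symm (V : TD)) * star (w : TD)) l'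
    (𝓝 (φ (φ.symm (hD.tmul 1 (φ.symm (V : TD)))))) at h4
  simp only [StarAlgEquiv.apply_symm_apply] at h4
  set s := hD.tmul 1 (φ.symm (V : TD)) with hs
  let U : unitary TD → unitary TD := fun w => star V * w * V * star w
  have h5 : ∀ y, Tendsto (fun w => star (U w : TD) * hD.tmul 1 y * (U w : TD)) l'
      (𝓝 (star s * (V * hD.tmul 1 y * star (V : TD)) * s)) := fun y => by
    refine ((h4.star.mul_const _).mul h4).congr fun w => ?_
    simp only [U, Submonoid.coe_mul, Unitary.coe_star, star_mul, star_star, mul_assoc]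
  have h6 : ∀ᶠ w in l', ∀ y ∈ F,
      ‖star (U w : TD) * hD.tmul 1 y * (U w : TD) - hD.tmul y 1‖ < ε := by
    rw [Filter.eventually_all_finset]
    intro y hy
    have h7 : ‖star s * (V * hD.tmul 1 y * star (V : TD)) * s - hD.tmul y 1‖ < ε := by
      have h8 : hD.tmul y 1 = star s * hD.tmul y 1 * s := by
        rw [mul_assoc, hs, hD.mul_tmul, hD.star_tmul, hD.mul_tmul, mul_one, one_mul, star_one,
          one_mul, ← map_star, ← map_mul, Unitary.coe_star_mul_self, map_one]
      have h9 : star s * (V * hD.tmul 1 y * star (V : TD)) * s - hD.tmul y 1 =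
          star s * (V * hD.tmul 1 y * star (V : TD) - hD.tmul y 1) * s := by
        rw [mul_sub, sub_mul, ← h8]
      have hs1 : ‖s‖ ≤ 1 := by
        refine le_of_tendsto h4.norm (Eventually.of_forall fun w => ?_)
        rw [← Unitary.coe_star, CStarRing.norm_mul_coe_unitary, CStarRing.norm_coe_unitary_mul]
        rcases subsingleton_or_nontrivial TD with h | h
        · simp [Subsingleton.elim (V : TD) 0]
        · exact (CStarRing.norm_of_mem_unitary V.2).le
      rw [h9]
      refine lt_of_le_of_lt ?_ (hV y hy)
      refine (norm_mul_le _ _).trans (mul_le_of_le_one_right (norm_nonneg _) hs1 |>.trans ?_)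
      refine (norm_mul_le _ _).trans (mul_le_of_le_one_left (norm_nonneg _) ?_)
      rwa [norm_star]
    exact ((h5 y).sub_const _).norm.eventually (gt_mem_nhds h7)
  obtain ⟨w, hw⟩ := h6.exists
  have h7 : Joined 1 (U w) := by
    have := hK1.joined_commutator φ (star V) w
    rw [star_star] at this
    exact this.symm
  obtain ⟨L, hL⟩ := Unitary.mem_pathComponentOne_iff.1 (mem_pathComponent_iff.2 h7)
  exact ⟨L, by rwa [hL]⟩

end ExpFlip

section Generated

variable {B D R T : Type u} [NonUnitalCStarAlgebra B] [CStarAlgebra D] [CStarAlgebra R]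
  [NonUnitalCStarAlgebra T]

/-- Commuting copies of `B` and of a simple unital algebra `D` generate an algebra which maps onto
the elementary tensors of the minimal tensor product. -/
lemma MinTensor.exists_hom_of_commute (hBD : MinTensor B D T)
    (hsimple : ∀ K : AddSubgroup D, (∀ a, ∀ x ∈ K, a * x ∈ K) → (∀ a, ∀ x ∈ K, x * a ∈ K) →
      ∀ y ∈ K, y ≠ 0 → 1 ∈ K)
    (k : B →⋆ₙₐ[ℂ] R) (hk : ∀ b, ‖k b‖ = ‖b‖) (g : D →⋆ₐ[ℂ] R)
    (hcomm : ∀ b y, k b * g y = g y * k b) :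
    ∃ (C : Type u) (_ : NonUnitalCStarAlgebra C) (ν : C →⋆ₙₐ[ℂ] R) (π : C →⋆ₙₐ[ℂ] T),
      Function.Injective ν ∧ IsClosed (Set.range ν) ∧
      ∀ b y, ∃ c, ν c = k b * g y ∧ π c = hBD.tmul b y := by
  let s : Set R := {r | ∃ b y, k b * g y = r}
  have hmul : ∀ b y b' y', k b * g y * (k b' * g y') = k (b * b') * g (y * y') := by
    intro b y b' y'
    rw [map_mul, map_mul, mul_assoc, ← mul_assoc (g y), ← hcomm]
    simp only [mul_assoc]
  have hstar : ∀ b y, star (k b * g y) = k (star b) * g (star y) := fun b y => by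
    rw [star_mul, map_star, map_star, ← map_star, ← map_star, hcomm]
  have hs : star s ⊆ s := by
    rintro r ⟨b, y, h⟩
    exact ⟨star b, star y, by rw [← hstar, h, star_star]⟩
  let P := NonUnitalStarAlgebra.adjoin ℂ s
  have hP : (P : Set R) = (Submodule.span ℂ s : Submodule ℂ R) := by
    have h1 : Subsemigroup.closure s = (⟨s, by
        rintro _ _ ⟨b, y, rfl⟩ ⟨b', y', rfl⟩
        exact ⟨_, _, (hmul b y b' y').symm⟩⟩ : Subsemigroup R) :=
      Subsemigroup.closure_eq (⟨s, _⟩ : Subsemigroup R)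
    have h2 := NonUnitalStarAlgebra.adjoin_eq_span (R := ℂ) s
    rw [Set.union_eq_left.2 hs, h1] at h2
    exact congrArg (fun Q : Submodule ℂ R => (Q : Set R)) h2
  let C := P.topologicalClosure
  have hC : IsClosed (C : Set R) := P.isClosed_topologicalClosure
  have hCmem : ∀ r, r ∈ C ↔ r ∈ closure ((Submodule.span ℂ s : Submodule ℂ R) : Set R) := fun r => by
    rw [← hP]; rfl
  have : Fact (IsClosed (C : Set R)) := ⟨hC⟩
  let : NonUnitalCStarAlgebra C := inferInstance
  have hsC : ∀ b y, k b * g y ∈ C := fun b y =>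
    P.le_topologicalClosure (NonUnitalStarAlgebra.subset_adjoin ℂ s ⟨b, y, rfl⟩)
  let ν : C →⋆ₙₐ[ℂ] R := NonUnitalStarSubalgebraClass.subtype C
  let h : CStarTensor B D C :=
    { tmul := fun b y => ⟨k b * g y, hsC b y⟩
      add_left := fun a a' b => Subtype.ext (by simp [add_mul])
      add_right := fun a b b' => Subtype.ext (by simp [mul_add])
      smul_left := fun c a b => Subtype.ext (by simp)
      smul_right := fun c a b => Subtype.ext (by simp)
      mul_tmul := fun a a' b b' => Subtype.ext (hmul a b a' b')
      star_tmul := fun a b => Subtype.ext (hstar a b)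
      norm_tmul := fun a b => by
        change ‖k a * g b‖ = _
        rw [norm_mul_of_commute_of_simple hsimple g (hcomm a), hk]
      dense_span := by
        rw [dense_iff_closure_eq, Set.eq_univ_iff_forall]
        intro c
        rw [IsInducing.subtypeVal.closure_eq_preimage_closure_image, Set.mem_preimage]
        have hc := (hCmem c).1 c.2
        convert hc using 2
        let L : C →ₗ[ℂ] R := (NonUnitalSubalgebraClass.subtype C : C →ₙₐ[ℂ] R)
        have : (Submodule.span ℂ {t : C | ∃ a b, ⟨k a * g b, hsC a b⟩ = t}).map L
            = Submodule.span ℂ s := by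
          rw [Submodule.map_span]
          congr 1
          ext r
          constructor
          · rintro ⟨_, ⟨a, b, rfl⟩, rfl⟩
            exact ⟨a, b, rfl⟩
          · rintro ⟨a, b, rfl⟩
            exact ⟨_, ⟨a, b, rfl⟩, rfl⟩
        rw [← this]
        rfl }
  obtain ⟨π, hπ⟩ := hBD.minimal C h
  refine ⟨C, inferInstance, ν, π, Subtype.val_injective, ?_, fun b y => ⟨_, rfl, hπ b y⟩⟩
  convert hC
  exact Subtype.range_coe

end Generated

section Intertwine

variable {B R I : Type*} [NormedRing R]

/-- The bounded families `f` and `g` asymptotically intertwine the elements `k b`. -/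
structure AsympIntertwine (k : B → R) (l : Filter I) (f g : I → R) : Prop where
  left : IsBoundedUnder (· ≤ ·) l (norm ∘ f)
  right : IsBoundedUnder (· ≤ ·) l (norm ∘ g)
  tendsto : ∀ b, Tendsto (fun i => f i * k b - k b * g i) l (𝓝 0)

lemma IsBoundedUnder.norm_mul {l : Filter I} {f g : I → R}
    (hf : IsBoundedUnder (· ≤ ·) l (norm ∘ f)) (hg : IsBoundedUnder (· ≤ ·) l (norm ∘ g)) :
    IsBoundedUnder (· ≤ ·) l (norm ∘ fun i => f i * g i) := by
  obtain ⟨M, hM⟩ := hf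
  obtain ⟨N, hN⟩ := hg
  rw [eventually_map] at hM hN
  refine ⟨M * N, ?_⟩
  rw [eventually_map]
  filter_upwards [hM, hN] with i h1 h2
  exact (norm_mul_le _ _).trans (mul_le_mul h1 h2 (norm_nonneg _) ((norm_nonneg _).trans h1))

variable {k : B → R} {l : Filter I} {f g f' g' : I → R}

namespace AsympIntertwine

lemma mul (h : AsympIntertwine k l f g) (h' : AsympIntertwine k l f' g') :
    AsympIntertwine k l (fun i => f i * f' i) (fun i => g i * g' i) where
  left := IsBoundedUnder.norm_mul h.left h'.left
  right := IsBoundedUnder.norm_mul h.right h'.right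
  tendsto b := by
    have h1 := isBoundedUnder_le_mul_tendsto_zero h.left (h'.tendsto b)
    have h2 := (h.tendsto b).zero_mul_isBoundedUnder_le h'.right
    have := h1.add h2
    rw [add_zero] at this
    refine this.congr fun i => ?_
    noncomm_ring

lemma const {r : R} (h : ∀ b, r * k b = k b * r) : AsympIntertwine k l (fun _ => r) fun _ => r where
  left := isBoundedUnder_const
  right := isBoundedUnder_const
  tendsto b := by simpa [h] using tendsto_const_nhds

lemma pow (h : AsympIntertwine k l f g) (n : ℕ) :
    AsympIntertwine k l (fun i => f i ^ n) fun i => g i ^ n := by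
  induction n with
  | zero => simpa using const (k := k) (l := l) (r := 1) fun b => by simp
  | succ n ih => simpa only [pow_succ] using ih.mul h

lemma list_prod {X : Type*} {F G : X → I → R} (L : List X)
    (h : ∀ x ∈ L, AsympIntertwine k l (F x) (G x)) :
    AsympIntertwine k l (fun i => (L.map fun x => F x i).prod)
      fun i => (L.map fun x => G x i).prod := by
  induction L with
  | nil => simpa using const (k := k) (l := l) (r := 1) fun b => by simp
  | cons x L ih =>
    simp only [List.map_cons, List.prod_cons]
    exact (h x (by simp)).mul (ih fun y hy => h y (by simp [hy]))

lemma const_smul [NormedAlgebra ℂ R] (h : AsympIntertwine k l f g) (c : ℂ) :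
    AsympIntertwine k l (fun i => c • f i) fun i => c • g i := by
  have : AsympIntertwine k l (fun _ => c • (1 : R)) fun _ => c • (1 : R) := const fun b => by simp
  simpa using this.mul h

lemma star [StarRing R] [NormedStarGroup R] [InvolutiveStar B] (h : AsympIntertwine k l f g)
    (hk : ∀ b, Star.star (k b) = k (Star.star b)) :
    AsympIntertwine k l (fun i => Star.star (g i)) fun i => Star.star (f i) where
  left := by
    simpa [Function.comp_def] using h.right
  right := by simpa [Function.comp_def] using h.left
  tendsto b := by
    have := (h.tendsto (Star.star b)).star.neg
    rw [star_zero, neg_zero] at this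
    refine this.congr fun i => ?_
    rw [star_sub, star_mul, star_mul, hk, star_star, neg_sub]

lemma exp [NormedAlgebra ℂ R] [CompleteSpace R] (h : AsympIntertwine k l f g)
    (hf : IsBoundedUnder (· ≤ ·) l (norm ∘ fun i => NormedSpace.exp (f i)))
    (hg : IsBoundedUnder (· ≤ ·) l (norm ∘ fun i => NormedSpace.exp (g i))) :
    AsympIntertwine k l (fun i => NormedSpace.exp (f i)) fun i => NormedSpace.exp (g i) where
  left := hf
  right := hg
  tendsto b := by
    obtain ⟨M, hM⟩ := h.left
    obtain ⟨N, hN⟩ := h.right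
    rw [eventually_map] at hM hN
    set K : ℝ := max M N
    have h1 : ∀ i, ∑' n : ℕ, (n.factorial : ℂ)⁻¹ • (f i ^ n * k b - k b * g i ^ n) =
        NormedSpace.exp (f i) * k b - k b * NormedSpace.exp (g i) := fun i => by
      have h2 := (NormedSpace.exp_series_hasSum_exp' (𝕂 := ℂ) (f i)).mul_right (k b)
      have h3 := (NormedSpace.exp_series_hasSum_exp' (𝕂 := ℂ) (g i)).mul_left (k b)
      rw [← (h2.sub h3).tsum_eq]
      simp only [smul_sub, smul_mul_assoc, mul_smul_comm]
    have hpow : ∀ (x : R) (n : ℕ), ‖x‖ ≤ K → ‖x ^ n * k b‖ ≤ K ^ n * ‖k b‖ ∧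
        ‖k b * x ^ n‖ ≤ K ^ n * ‖k b‖ := fun x n hx => by
      have hK : 0 ≤ K := (norm_nonneg _).trans hx
      induction n with
      | zero => simp
      | succ n ih =>
        constructor
        · rw [pow_succ', mul_assoc, pow_succ', mul_assoc]
          exact (norm_mul_le _ _).trans (mul_le_mul hx ih.1 (norm_nonneg _) hK)
        · rw [pow_succ, ← mul_assoc, pow_succ, mul_right_comm]
          exact (norm_mul_le _ _).trans (mul_le_mul ih.2 hx (norm_nonneg _) (by positivity))
    have h2 : Tendsto (fun i => ∑' n : ℕ, (n.factorial : ℂ)⁻¹ • (f i ^ n * k b - k b * g i ^ n)) l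
        (𝓝 (∑' _ : ℕ, 0)) := by
      refine tendsto_tsum_of_dominated_convergence
        ((Real.summable_pow_div_factorial K).mul_right (2 * ‖k b‖)) (fun n => ?_) ?_
      · simpa using ((h.pow n).tendsto b).const_smul (n.factorial : ℂ)⁻¹
      · filter_upwards [hM, hN] with i hi hi' n
        rw [norm_smul, norm_inv, Complex.norm_natCast, div_eq_inv_mul, mul_assoc]
        gcongr
        refine (norm_sub_le _ _).trans ((add_le_add (hpow _ n (hi.trans (le_max_left _ _))).1
          (hpow _ n (hi'.trans (le_max_right _ _))).2).trans_eq (by ring))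
    rw [tsum_zero] at h2
    exact h2.congr h1

end AsympIntertwine

end Intertwine

section Lifting

variable {B C D R TD : Type*} [NonUnitalCStarAlgebra B] [NonUnitalCStarAlgebra C]
  [CStarAlgebra D] [CStarAlgebra R] [CStarAlgebra TD]

lemma norm_le_one_of_mem_unitary {u : R} (hu : u ∈ unitary R) : ‖u‖ ≤ 1 := by
  rcases subsingleton_or_nontrivial R with h | h
  · rw [Subsingleton.elim u 0, norm_zero]
    exact zero_le_one
  · exact (CStarRing.norm_of_mem_unitary hu).le

lemma CStarTensor.tmul_factor (hD : CStarTensor D D TD) (x y : D) :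
    hD.tmul x y = hD.tmul x 1 * hD.tmul 1 y := by
  rw [hD.mul_tmul, mul_one, one_mul]

/-- Compressions of the image of `D ⊗ D` to a hereditary copy of `B`. -/
lemma CStarTensor.compression_mem_range (hD : CStarTensor D D TD)
    (k : B →⋆ₙₐ[ℂ] R) (Φ : TD →⋆ₐ[ℂ] R)
    (hcomm : ∀ b y, k b * Φ (hD.tmul 1 y) = Φ (hD.tmul 1 y) * k b)
    (hher : ∀ b x b', ∃ b'', k b * Φ (hD.tmul x 1) * k b' = k b'')
    (ν : C →⋆ₙₐ[ℂ] R) (hν : IsClosed (Set.range ν))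
    (hνk : ∀ b y, k b * Φ (hD.tmul 1 y) ∈ Set.range ν) (b b' : B) (z : TD) :
    k b * Φ z * k b' ∈ Set.range ν := by
  refine forall_of_dense_span hD.dense_span (fun z => k b * Φ z * k b' ∈ Set.range ν) ?_ ?_ ?_ ?_ ?_ z
  · rintro _ ⟨x, y, rfl⟩
    obtain ⟨b'', hb⟩ := hher b x b'
    rw [hD.tmul_factor, map_mul, ← mul_assoc, mul_assoc, ← hcomm, ← mul_assoc, hb]
    exact hνk b'' y
  · exact ⟨0, by simp⟩
  · rintro x y ⟨c, hc⟩ ⟨d, hd⟩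
    exact ⟨c + d, by rw [map_add, hc, hd, map_add]; noncomm_ring⟩
  · rintro t x ⟨c, hc⟩
    exact ⟨t • c, by rw [map_smul, hc, map_smul, mul_smul_comm, smul_mul_assoc]⟩
  · intro x hx
    have : k b * Φ x * k b' ∈ closure (Set.range ν) := by
      have hcont : Continuous fun z => k b * Φ z * k b' :=
        (continuous_const.mul (map_continuous Φ)).mul continuous_const
      refine hcont.closure_preimage_subset _ (?_ : x ∈ closure _)
      refine Metric.mem_closure_iff.2 fun ε hε => ?_
      obtain ⟨y, hy, hxy⟩ := hx ε hε
      exact ⟨y, hy, by rwa [dist_eq_norm]⟩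
    rwa [hν.closure_eq] at this

/-- Conjugation of `Φ` by a unitary of the first tensor factor. -/
def CStarTensor.twistedHom (hD : CStarTensor D D TD) (hDu : hD.tmul 1 1 = 1) (Φ : TD →⋆ₐ[ℂ] R)
    (W : unitary D) : TD →⋆ₐ[ℂ] R :=
  Φ.comp (Unitary.conjStarAlgAut ℂ TD
    ⟨hD.tmul W 1, Unitary.map_mem (hD.inl.toUnital hDu) W.2⟩ : TD →⋆ₐ[ℂ] TD)

lemma CStarTensor.twistedHom_tmul (hD : CStarTensor D D TD) (hDu : hD.tmul 1 1 = 1)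
    (Φ : TD →⋆ₐ[ℂ] R) (W : unitary D) (x y : D) :
    hD.twistedHom hDu Φ W (hD.tmul x y) = Φ (hD.tmul (W * x * star (W : D)) y) := by
  change Φ (hD.tmul W 1 * hD.tmul x y * star (hD.tmul W 1)) = _
  rw [hD.star_tmul, hD.mul_tmul, hD.mul_tmul, star_one, mul_one, one_mul]

lemma norm_starAlgHom_apply_le (f : TD →⋆ₐ[ℂ] R) (z : TD) : ‖f z‖ ≤ ‖z‖ :=
  NonUnitalStarAlgHom.norm_apply_le f z

lemma CStarTensor.asympIntertwine_twistedHom (hD : CStarTensor D D TD) (hDu : hD.tmul 1 1 = 1)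
    (Φ : TD →⋆ₐ[ℂ] R) (k : B →⋆ₙₐ[ℂ] R) (l : Filter (unitary D))
    (hcomm : ∀ b y, k b * Φ (hD.tmul 1 y) = Φ (hD.tmul 1 y) * k b)
    (hW : ∀ b x, Tendsto (fun W : unitary D => Φ (hD.tmul (W * x * star (W : D)) 1) * k b -
        k b * Φ (hD.tmul (W * x * star (W : D)) 1)) l (𝓝 0)) (z : TD) :
    AsympIntertwine k l (fun W => hD.twistedHom hDu Φ W z) fun W => hD.twistedHom hDu Φ W z := by
  have hbdd : ∀ z, IsBoundedUnder (· ≤ ·) l (norm ∘ fun W => hD.twistedHom hDu Φ W z) := fun z =>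
    isBoundedUnder_of ⟨‖z‖, fun W => norm_starAlgHom_apply_le _ z⟩
  refine ⟨hbdd z, hbdd z, fun b => ?_⟩
  let T : unitary D → TD →ₗ[ℂ] R := fun W =>
    { toFun := fun z => hD.twistedHom hDu Φ W z * k b - k b * hD.twistedHom hDu Φ W z
      map_add' := fun x y => by rw [map_add]; noncomm_ring
      map_smul' := fun c x => by
        rw [map_smul, mul_smul_comm, smul_mul_assoc, ← smul_sub, RingHom.id_apply] }
  refine tendsto_zero_of_dense_span hD.dense_span T (2 * ‖k b‖) (.of_forall fun W x => ?_) ?_ z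
  · refine (norm_sub_le _ _).trans ((add_le_add (norm_mul_le _ _) (norm_mul_le _ _)).trans ?_)
    have := mul_le_mul_of_nonneg_left (norm_starAlgHom_apply_le (hD.twistedHom hDu Φ W) x)
      (norm_nonneg (k b))
    linarith
  · rintro _ ⟨x, y, rfl⟩
    have h1 : AsympIntertwine k l (fun W : unitary D => Φ (hD.tmul (W * x * star (W : D)) 1))
        fun W : unitary D => Φ (hD.tmul (W * x * star (W : D)) 1) := by
      have h : IsBoundedUnder (· ≤ ·) l
          (norm ∘ fun W : unitary D => Φ (hD.tmul (W * x * star (W : D)) 1)) := by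
        simpa only [hD.twistedHom_tmul] using hbdd (hD.tmul x 1)
      exact ⟨h, h, fun b => hW b x⟩
    have h2 : AsympIntertwine k l (fun _ => Φ (hD.tmul 1 y)) fun _ => Φ (hD.tmul 1 y) :=
      .const fun b => (hcomm b y).symm
    refine ((h1.mul h2).tendsto b).congr fun W => ?_
    change _ = hD.twistedHom hDu Φ W (hD.tmul x y) * k b - k b * hD.twistedHom hDu Φ W (hD.tmul x y)
    rw [hD.twistedHom_tmul, ← map_mul, ← hD.tmul_factor]

lemma AsympIntertwine.comp_tendsto {B R I J : Type*} [NormedRing R] {k : B → R} {l : Filter I}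
    {f g : I → R} (h : AsympIntertwine k l f g) {l' : Filter J} {m : J → I}
    (hm : Tendsto m l' l) : AsympIntertwine k l' (fun j => f (m j)) fun j => g (m j) where
  left := by
    obtain ⟨M, hM⟩ := h.left
    exact ⟨M, eventually_map.2 (hm.eventually (eventually_map.1 hM))⟩
  right := by
    obtain ⟨M, hM⟩ := h.right
    exact ⟨M, eventually_map.2 (hm.eventually (eventually_map.1 hM))⟩
  tendsto b := (h.tendsto b).comp hm

lemma map_cexp (f : TD →⋆ₐ[ℂ] R) (x : TD) : f (NormedSpace.exp x) = NormedSpace.exp (f x) := by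
  let := NormedAlgebra.restrictScalars ℚ ℂ TD
  let := NormedAlgebra.restrictScalars ℚ ℂ R
  exact NormedSpace.map_exp f (map_continuous f) x

lemma exp_I_smul_mem_unitary {h : R} (hh : IsSelfAdjoint h) :
    NormedSpace.exp (Complex.I • h) ∈ unitary R :=
  (selfAdjoint.expUnitary ⟨h, hh⟩).2

lemma AsympIntertwine.exp_I {B I : Type*} {k : B → R} {l : Filter I} {f g : I → R}
    (h : AsympIntertwine k l f g) (hf : ∀ i, IsSelfAdjoint (f i)) (hg : ∀ i, IsSelfAdjoint (g i)) :
    AsympIntertwine k l (fun i => NormedSpace.exp (Complex.I • f i))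
      fun i => NormedSpace.exp (Complex.I • g i) :=
  (h.const_smul Complex.I).exp
    (isBoundedUnder_of ⟨1, fun i => norm_le_one_of_mem_unitary (exp_I_smul_mem_unitary (hf i))⟩)
    (isBoundedUnder_of ⟨1, fun i => norm_le_one_of_mem_unitary (exp_I_smul_mem_unitary (hg i))⟩)

/-- An exponential conjugation which approximately exchanges the tensor factors can be replaced,
relative to `B`, by one whose exponents lie in the range of `ν`. -/
lemma CStarTensor.exists_exp_absorbing (hD : CStarTensor D D TD) (hDu : hD.tmul 1 1 = 1)
    (hflip : ∀ (F : Finset D) (ε : ℝ), 0 < ε → ∃ L : List (selfAdjoint TD), ∀ y ∈ F,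
      ‖star ((L.map selfAdjoint.expUnitary).prod : TD) * hD.tmul 1 y *
        ((L.map selfAdjoint.expUnitary).prod : TD) - hD.tmul y 1‖ < ε)
    (Φ : TD →⋆ₐ[ℂ] R) (k : B →⋆ₙₐ[ℂ] R) (l : Filter (unitary D)) [l.NeBot]
    (hcomm : ∀ b y, k b * Φ (hD.tmul 1 y) = Φ (hD.tmul 1 y) * k b)
    (hher : ∀ b x b', ∃ b'', k b * Φ (hD.tmul x 1) * k b' = k b'')
    (hW : ∀ b x, Tendsto (fun W : unitary D => Φ (hD.tmul (W * x * star (W : D)) 1) * k b -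
        k b * Φ (hD.tmul (W * x * star (W : D)) 1)) l (𝓝 0))
    (ν : C →⋆ₙₐ[ℂ] R) (hνinj : Function.Injective ν) (hν : IsClosed (Set.range ν))
    (hνk : ∀ b y, k b * Φ (hD.tmul 1 y) ∈ Set.range ν) (S : Finset (B × D)) {ε : ℝ} (hε : 0 < ε) :
    ∃ L : List C, (∀ c ∈ L, IsSelfAdjoint c) ∧ ∃ V : R,
      V = (L.map fun c => NormedSpace.exp (Complex.I • ν c)).prod ∧ ∀ p ∈ S,
      ‖star V * k p.1 * V - k p.1‖ < ε ∧
      ∃ b'', ‖star V * (k p.1 * Φ (hD.tmul 1 p.2)) * V - k b''‖ < ε := by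
  classical
  let := CStarAlgebra.spectralOrder B
  have := CStarAlgebra.spectralOrderedRing B
  have hunit := CStarAlgebra.increasingApproximateUnit B
  set lB := CStarAlgebra.approximateUnit B
  have : lB.NeBot := hunit.neBot
  let I := B × unitary D
  let lI : Filter I := lB ×ˢ l
  have hfst : Tendsto Prod.fst lI lB := tendsto_fst
  have hsnd : Tendsto Prod.snd lI l := tendsto_snd
  let Ψ : I → TD →⋆ₐ[ℂ] R := fun i => hD.twistedHom hDu Φ i.2
  let E : I → R := fun i => k i.1
  have hkc : Continuous k := map_continuous k
  have hEl : ∀ b, Tendsto (fun i => E i * k b - k b) lI (𝓝 0) := fun b => by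
    have := ((hkc.tendsto _).comp (hunit.tendsto_mul_right b)).sub_const (k b)
    rw [sub_self] at this
    refine (this.comp hfst).congr fun i => ?_
    simp [E]
  have hEr : ∀ b, Tendsto (fun i => k b - k b * E i) lI (𝓝 0) := fun b => by
    have := ((hkc.tendsto _).comp (hunit.tendsto_mul_left b)).const_sub (k b)
    rw [sub_self] at this
    refine (this.comp hfst).congr fun i => ?_
    simp [E]
  have hEbdd : IsBoundedUnder (· ≤ ·) lI (norm ∘ E) := by
    refine ⟨1, ?_⟩
    rw [eventually_map]
    filter_upwards [hfst.eventually hunit.eventually_norm] with i hi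
    exact (NonUnitalStarAlgHom.norm_apply_le k i.1).trans hi
  have hE1 : AsympIntertwine k lI E fun _ => 1 :=
    ⟨hEbdd, isBoundedUnder_const, fun b => by simpa using hEl b⟩
  have h1E : AsympIntertwine k lI (fun _ => 1) E :=
    ⟨isBoundedUnder_const, hEbdd, fun b => by simpa using hEr b⟩
  have hEE : AsympIntertwine k lI E E :=
    ⟨hEbdd, hEbdd, fun b => by simpa using (hEl b).add (hEr b)⟩
  have hks : ∀ b, star (k b) = k (star b) := fun b => (map_star k b).symm
  have hEsEs := hEE.star hks
  have h1Es := hE1.star hks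
  simp only [star_one] at h1Es
  have hG : ∀ z, AsympIntertwine k lI (fun i => Ψ i z) fun i => Ψ i z := fun z =>
    (hD.asympIntertwine_twistedHom hDu Φ k l hcomm hW z).comp_tendsto hsnd
  let H : selfAdjoint TD → I → R := fun h i => star (E i) * Ψ i h * E i
  have hHH : ∀ h, AsympIntertwine k lI (H h) (H h) := fun h => (hEsEs.mul (hG h)).mul hEE
  have hGH : ∀ h : selfAdjoint TD, AsympIntertwine k lI (fun i => Ψ i h) (H h) := fun h => by
    simpa using (h1Es.mul (hG h)).mul h1E
  have hΨsa : ∀ (h : selfAdjoint TD) i, IsSelfAdjoint (Ψ i h) := fun h i => by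
    rw [isSelfAdjoint_iff, ← map_star, h.2.star_eq]
  have hHsa : ∀ (h : selfAdjoint TD) i, IsSelfAdjoint (H h i) := fun h i =>
    (hΨsa h i).conjugate' (E i)
  have hHν : ∀ (h : selfAdjoint TD) i, ∃ c, ν c = H h i := fun h i => by
    have := hD.compression_mem_range k Φ hcomm hher ν hν hνk (star i.1) i.1
      (Unitary.conjStarAlgAut ℂ TD
        ⟨hD.tmul i.2 1, Unitary.map_mem (hD.inl.toUnital hDu) i.2.2⟩ h)
    rw [map_star] at this
    exact this
  choose c hc using hHν
  obtain ⟨M, hM0, hM⟩ : ∃ M : ℝ, 0 < M ∧ ∀ p ∈ S, ‖k p.1‖ ≤ M := by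
    obtain ⟨M, hM⟩ := (S.image fun p => ‖k p.1‖).bddAbove
    exact ⟨max M 1, by positivity, fun p hp => le_max_of_le_left
      (hM (Finset.mem_coe.2 (Finset.mem_image_of_mem _ hp)))⟩
  obtain ⟨L, hL⟩ := hflip (S.image Prod.snd) (ε / 2 / M) (by positivity)
  set U₀ : unitary TD := (L.map selfAdjoint.expUnitary).prod with hU₀
  let U : I → R := fun i => Ψ i U₀
  let V : I → R := fun i => (L.map fun h => NormedSpace.exp (Complex.I • H h i)).prod
  have hU : ∀ i, U i = (L.map fun h : selfAdjoint TD =>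
      NormedSpace.exp (Complex.I • Ψ i h)).prod := fun i => by
    change Ψ i ((L.map selfAdjoint.expUnitary).prod : unitary TD) = _
    rw [Submonoid.coe_list_prod, map_list_prod, List.map_map, List.map_map]
    congr 1
    refine List.map_congr_left fun h _ => ?_
    simp only [Function.comp_apply, selfAdjoint.expUnitary_coe]
    rw [← map_smul]
    exact map_cexp _ _
  have hVV : AsympIntertwine k lI V V :=
    .list_prod L fun h _ => (hHH h).exp_I (hHsa h) (hHsa h)
  have hUV : AsympIntertwine k lI U V := by
    rw [show U = _ from funext hU]
    exact .list_prod L fun h _ => (hGH h).exp_I (hΨsa h) (hHsa h)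
  have hUU : AsympIntertwine k lI U U := hG U₀
  have hVmem : ∀ i, V i ∈ unitary R := fun i => list_prod_mem fun x hx => by
    obtain ⟨h, -, rfl⟩ := List.mem_map.1 hx
    exact exp_I_smul_mem_unitary (hHsa h i)
  have hbV : IsBoundedUnder (· ≤ ·) lI (norm ∘ fun i => star (V i)) := (hVV.star hks).left
  have est1 : ∀ b, Tendsto (fun i => star (V i) * k b * V i - k b) lI (𝓝 0) := fun b => by
    have h := (isBoundedUnder_le_mul_tendsto_zero hbV (hVV.tendsto b)).neg
    rw [neg_zero] at h
    refine h.congr fun i => ?_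
    have := Unitary.star_mul_self_of_mem (hVmem i)
    rw [mul_sub, ← mul_assoc, this, one_mul, neg_sub, mul_assoc]
  have est2 : ∀ b y, Tendsto (fun i => star (V i) * (k b * Φ (hD.tmul 1 y)) * V i -
      k b * (star (U i) * Φ (hD.tmul 1 y) * U i)) lI (𝓝 0) := fun b y => by
    have hgy : AsympIntertwine k lI (fun _ => Φ (hD.tmul 1 y)) fun _ => Φ (hD.tmul 1 y) :=
      .const fun b => (hcomm b y).symm
    have h1 := ((hUV.star hks).mul hgy)
    have h2 := isBoundedUnder_le_mul_tendsto_zero h1.left (hUV.tendsto b)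
    have h3 := ((h1.mul hUU).tendsto b).sub h2
    rw [sub_zero] at h3
    refine h3.congr fun i => ?_
    rw [hcomm]
    noncomm_ring
  have hΨ1 : ∀ i y, Ψ i (hD.tmul 1 y) = Φ (hD.tmul 1 y) := fun i y => by
    change hD.twistedHom hDu Φ i.2 _ = _
    rw [hD.twistedHom_tmul, mul_one, Unitary.mul_star_self_of_mem i.2.2]
  have est3 : ∀ p ∈ S, ∀ i, ‖k p.1 * (star (U i) * Φ (hD.tmul 1 p.2) * U i) -
      k p.1 * Ψ i (hD.tmul p.2 1)‖ ≤ ε / 2 := fun p hp i => by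
    have h1 : star (U i) * Φ (hD.tmul 1 p.2) * U i - Ψ i (hD.tmul p.2 1) =
        Ψ i (star (U₀ : TD) * hD.tmul 1 p.2 * U₀ - hD.tmul p.2 1) := by
      rw [map_sub, map_mul, map_mul, map_star, hΨ1]
    rw [← mul_sub, h1]
    refine (norm_mul_le _ _).trans ((mul_le_mul (hM p hp) ((norm_starAlgHom_apply_le _ _).trans
      (hL p.2 (Finset.mem_image_of_mem _ hp)).le) (norm_nonneg _) hM0.le).trans_eq ?_)
    field_simp
  have est4 : ∀ b y, Tendsto (fun i => k b * Ψ i (hD.tmul y 1) -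
      E i * Ψ i (hD.tmul y 1) * k b) lI (𝓝 0) := fun b y => by
    have h := (((hE1.mul (hG (hD.tmul y 1))).tendsto b)).neg
    rw [neg_zero] at h
    refine h.congr fun i => ?_
    rw [one_mul, neg_sub]
  have hmem : ∀ i b y, ∃ b'', E i * Ψ i (hD.tmul y 1) * k b = k b'' := fun i b y => by
    obtain ⟨b'', h⟩ := hher i.1 (i.2 * y * star (i.2 : D)) b
    refine ⟨b'', ?_⟩
    rw [← h, ← hD.twistedHom_tmul hDu]
  have hev : ∀ᶠ i in lI, ∀ p ∈ S, ‖star (V i) * k p.1 * V i - k p.1‖ < ε ∧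
      ‖star (V i) * (k p.1 * Φ (hD.tmul 1 p.2)) * V i -
        k p.1 * (star (U i) * Φ (hD.tmul 1 p.2) * U i)‖ < ε / 4 ∧
      ‖k p.1 * Ψ i (hD.tmul p.2 1) - E i * Ψ i (hD.tmul p.2 1) * k p.1‖ < ε / 4 := by
    rw [Filter.eventually_all_finset]
    intro p _
    filter_upwards [(est1 p.1).eventually (Metric.ball_mem_nhds _ hε),
      (est2 p.1 p.2).eventually (Metric.ball_mem_nhds _ (by positivity : 0 < ε / 4)),
      (est4 p.1 p.2).eventually (Metric.ball_mem_nhds _ (by positivity : 0 < ε / 4))]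
      with i h1 h2 h3
    rw [dist_zero_right] at h1 h2 h3
    exact ⟨h1, h2, h3⟩
  obtain ⟨i, hi⟩ := hev.exists
  refine ⟨L.map fun h => c h i, ?_, V i, ?_, fun p hp => ⟨(hi p hp).1, ?_⟩⟩
  · intro x hx
    obtain ⟨h, -, rfl⟩ := List.mem_map.1 hx
    refine hνinj ?_
    rw [map_star, hc]
    exact hHsa h i
  · rw [List.map_map]
    simp only [V, Function.comp_def, hc]
  · obtain ⟨b'', hb⟩ := hmem i p.1 p.2
    refine ⟨b'', ?_⟩
    rw [← hb]
    obtain ⟨-, h1, h2⟩ := hi p hp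
    have h3 := est3 p hp i
    have := norm_sub_le_norm_sub_add_norm_sub (star (V i) * (k p.1 * Φ (hD.tmul 1 p.2)) * V i)
      (k p.1 * (star (U i) * Φ (hD.tmul 1 p.2) * U i)) (E i * Ψ i (hD.tmul p.2 1) * k p.1)
    have := norm_sub_le_norm_sub_add_norm_sub
      (k p.1 * (star (U i) * Φ (hD.tmul 1 p.2) * U i)) (k p.1 * Ψ i (hD.tmul p.2 1))
      (E i * Ψ i (hD.tmul p.2 1) * k p.1)
    linarith

end Lifting

section Transfer

/-- The automorphism of an algebra obtained by conjugation with a unitary of its unitization. -/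
lemma exists_conj_unitization {A : Type*} [NonUnitalCStarAlgebra A] (v : unitary (Unitization ℂ A)) :
    ∃ σ : A ≃⋆ₐ[ℂ] A, ∀ a, ((σ a : A) : Unitization ℂ A) = star (v : Unitization ℂ A) * a * v := by
  have h1 : ∀ (w : Unitization ℂ A) (a : A),
      (((star w * a * w).snd : A) : Unitization ℂ A) = star w * a * w := fun w a => by
    ext <;> simp
  have hv1 : star (v : Unitization ℂ A) * v = 1 := Unitary.coe_star_mul_self v
  have hv2 : (v : Unitization ℂ A) * star (v : Unitization ℂ A) = 1 := Unitary.coe_mul_star_self v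
  refine ⟨{ toFun := fun a => (star (v : Unitization ℂ A) * a * v).snd
            invFun := fun a => ((v : Unitization ℂ A) * a * star (v : Unitization ℂ A)).snd
            left_inv := fun a => ?_
            right_inv := fun a => ?_
            map_mul' := fun a b => ?_
            map_add' := fun a b => ?_
            map_star' := fun a => ?_
            map_smul' := fun c a => ?_ }, fun a => h1 v a⟩
  all_goals apply Unitization.inr_injective (R := ℂ)
  · have := h1 (star v) (star (v : Unitization ℂ A) * a * v).snd
    rw [star_star] at this
    rw [this, h1]
    calc _ = ((v : Unitization ℂ A) * star (v : Unitization ℂ A)) * a *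
        ((v : Unitization ℂ A) * star (v : Unitization ℂ A)) := by noncomm_ring
      _ = _ := by rw [hv2, one_mul, mul_one]
  · have := h1 (star v) a
    rw [star_star] at this
    rw [h1, this]
    calc _ = (star (v : Unitization ℂ A) * v) * a *
        (star (v : Unitization ℂ A) * v) := by noncomm_ring
      _ = _ := by rw [hv1, one_mul, mul_one]
  · rw [h1, Unitization.inr_mul, Unitization.inr_mul, h1, h1]
    calc _ = star (v : Unitization ℂ A) * a * 1 * b * v := by noncomm_ring
      _ = _ := by rw [← hv2]; noncomm_ring
  · rw [h1, Unitization.inr_add, Unitization.inr_add, h1, h1]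
    noncomm_ring
  · rw [h1, Unitization.inr_star, Unitization.inr_star, h1]
    simp only [star_mul, star_star, mul_assoc]
  · rw [h1, Unitization.inr_smul, Unitization.inr_smul, h1, mul_smul_comm, smul_mul_assoc]

variable {C R T : Type*} [NonUnitalCStarAlgebra C] [CStarAlgebra R] [NonUnitalCStarAlgebra T]

/-- Conjugation by a product of exponentials of elements of `C`, seen on a faithful representation
`ν` of `C` and on another image `π` of `C`. -/
lemma exists_conj_of_exp (ν : C →⋆ₙₐ[ℂ] R) (hν : Function.Injective ν) (π : C →⋆ₙₐ[ℂ] T)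
    (L : List C) (hL : ∀ c ∈ L, IsSelfAdjoint c) :
    ∃ σ : T ≃⋆ₐ[ℂ] T, ∀ c c', ‖σ (π c) - π c'‖ ≤
      ‖star (L.map fun c => NormedSpace.exp (Complex.I • ν c)).prod * ν c *
        (L.map fun c => NormedSpace.exp (Complex.I • ν c)).prod - ν c'‖ := by
  let v : Unitization ℂ C :=
    (L.map fun c : C => NormedSpace.exp (Complex.I • (c : Unitization ℂ C))).prod
  have hv : v ∈ unitary (Unitization ℂ C) := list_prod_mem fun x hx => by
    obtain ⟨c, hc, rfl⟩ := List.mem_map.1 hx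
    refine exp_I_smul_mem_unitary ?_
    rw [isSelfAdjoint_iff, ← Unitization.inr_star, (hL c hc).star_eq]
  let νu : Unitization ℂ C →⋆ₐ[ℂ] R := Unitization.starLift ν
  let πu : Unitization ℂ C →⋆ₐ[ℂ] Unitization ℂ T := Unitization.starMap π
  have hνu : ∀ c : C, νu (c : Unitization ℂ C) = ν c := fun c =>
    DFunLike.congr_fun (Unitization.starLift.symm_apply_apply ν) c
  have hπu : ∀ c : C, πu (c : Unitization ℂ C) = (π c : T) := fun c => Unitization.starMap_inr π c
  have hνv : νu v = (L.map fun c => NormedSpace.exp (Complex.I • ν c)).prod := by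
    simp only [v]
    rw [map_list_prod, List.map_map]
    congr 1
    refine List.map_congr_left fun c _ => ?_
    rw [Function.comp_apply, map_cexp, map_smul, hνu]
  obtain ⟨σ, hσ⟩ := exists_conj_unitization (⟨πu v, Unitary.map_mem πu hv⟩ : unitary (Unitization ℂ T))
  obtain ⟨τ, hτ⟩ := exists_conj_unitization (⟨v, hv⟩ : unitary (Unitization ℂ C))
  refine ⟨σ, fun c c' => ?_⟩
  have h1 : σ (π c) = π (τ c) := by
    apply Unitization.inr_injective (R := ℂ)
    rw [hσ, ← hπu, ← hπu, hτ, map_mul, map_mul, map_star]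
  have h2 : ν (τ c) = star (νu v) * ν c * νu v := by
    rw [← hνu, hτ, map_mul, map_mul, map_star, hνu]
  rw [← hνv, ← h2, h1, ← map_sub, ← map_sub, NonUnitalStarAlgHom.norm_map ν hν]
  exact NonUnitalStarAlgHom.norm_apply_le π _

end Transfer

section Main

variable {A B D TD AD BD : Type u} [NonUnitalCStarAlgebra A] [NonUnitalCStarAlgebra B]
  [CStarAlgebra D] [CStarAlgebra TD] [NonUnitalCStarAlgebra AD] [NonUnitalCStarAlgebra BD]

/-- Approximate intertwiners on the tensor product of a hereditary subalgebra with `D`. -/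
lemma MinTensor.exists_approx_intertwiner (hD : MinTensor D D TD) (hDu : hD.tmul 1 1 = 1)
    (φ : D ≃⋆ₐ[ℂ] TD) (hφ : AU φ hD.fst) (hK1 : K1Injective D) (hAD : CStarTensor A D AD)
    (α : AD ≃⋆ₐ[ℂ] A) (β : B →⋆ₙₐ[ℂ] A) (hβ : Function.Injective β)
    (hher : ∀ a ∈ Set.range β, CStarNonneg a →
      ∀ b : A, CStarNonneg b → CStarNonneg (a - b) → b ∈ Set.range β)
    (hBD : MinTensor B D BD) (S : Finset (B × D)) {ε : ℝ} (hε : 0 < ε) :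
    ∃ σ : BD ≃⋆ₐ[ℂ] BD, ∀ p ∈ S, ‖σ (hBD.tmul p.1 1) - hBD.tmul p.1 1‖ < ε ∧
      ∃ b, ‖σ (hBD.tmul p.1 p.2) - hBD.tmul b 1‖ < ε := by
  obtain ⟨h1, h2⟩ := hD.au_factor_embeddings hDu φ hφ
  have hflip' : AU (fun d => φ.symm (hD.tmul d 1)) fun d => φ.symm (hD.tmul 1 d) := h1.symm.trans h2
  have hflip : AU (fun d => hD.tmul d 1) fun d => hD.tmul 1 d := by
    simpa using hflip'.map (φ : D →⋆ₐ[ℂ] TD)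
  have hsimple : ∀ K : AddSubgroup D, (∀ a, ∀ x ∈ K, a * x ∈ K) → (∀ a, ∀ x ∈ K, x * a ∈ K) →
      ∀ y ∈ K, y ≠ 0 → 1 ∈ K := fun K hl hr y hy hy0 =>
    one_mem_of_au_half_flip hD.toCStarTensor hflip hl hr hy hy0
  obtain ⟨R, _, k, Φ, l, hl, hk, hcomm, hkher, hW⟩ :=
    exists_hereditary_representation hD φ h1 h2 hAD α β hβ hher
  obtain ⟨C, _, ν, π, hνi, hνc, hC⟩ := hBD.exists_hom_of_commute hsimple k hk
    (Φ.comp (hD.inr.toUnital hDu)) hcomm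
  obtain ⟨L, hL, V, hV, hLV⟩ := hD.exists_exp_absorbing hDu
    (fun F ε hε => exists_exp_flip hD φ hK1 hflip.symm h2 F hε) Φ k l hcomm hkher hW ν hνi hνc
    (fun b y => (hC b y).imp fun c hc => hc.1) S hε
  obtain ⟨σ, hσ⟩ := exists_conj_of_exp ν hνi π L hL
  rw [← hV] at hσ
  have hone : ∀ b, ∃ c, ν c = k b ∧ π c = hBD.tmul b 1 := fun b => by
    obtain ⟨c, hc, hc'⟩ := hC b 1
    exact ⟨c, by rw [hc, map_one, mul_one], hc'⟩
  refine ⟨σ, fun p hp => ?_⟩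
  obtain ⟨e1, b, e2⟩ := hLV p hp
  obtain ⟨c, hc, hc'⟩ := hone p.1
  obtain ⟨d, hd, hd'⟩ := hone b
  obtain ⟨y, hy, hy'⟩ := hC p.1 p.2
  refine ⟨?_, b, ?_⟩
  · rw [← hc']
    refine (hσ c c).trans_lt ?_
    rwa [hc]
  · rw [← hy', ← hd']
    refine (hσ y d).trans_lt ?_
    rw [hy, hd]
    exact e2

end Main

lemma CStarTensor.norm_inl {A D T : Type*} [NonUnitalCStarAlgebra A] [CStarAlgebra D]
    [NonUnitalCStarAlgebra T] [Nontrivial D] (h : CStarTensor A D T) (a : A) :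
    ‖h.inl a‖ = ‖a‖ := by
  rw [h.inl_apply, h.norm_tmul, CStarRing.norm_one, mul_one]

lemma CStarTensor.subsingleton {A D T : Type*} [NonUnitalCStarAlgebra A] [CStarAlgebra D]
    [NonUnitalCStarAlgebra T] [Subsingleton D] (h : CStarTensor A D T) : Subsingleton T := by
  have h0 : ∀ t : T, t = 0 := forall_of_dense_span h.dense_span (fun t => t = 0)
    (by rintro _ ⟨a, d, rfl⟩; rw [Subsingleton.elim d 0, h.zero_right]) rfl
    (by rintro _ _ rfl rfl; exact add_zero 0) (by rintro c _ rfl; exact smul_zero c)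
    (fun x hx => norm_le_zero_iff.1 (le_of_forall_pos_lt_add fun ε hε => by
      obtain ⟨y, rfl, h⟩ := hx ε hε
      simpa using h))
  exact ⟨fun a b => (h0 a).trans (h0 b).symm⟩

/-- Distances to the range of a star homomorphism vanish asymptotically along a family of
automorphisms as soon as they do on a total set. -/
lemma tendsto_infDist_range_of_dense_span {B C : Type*} [NonUnitalCStarAlgebra B]
    [NonUnitalCStarAlgebra C] (ι : B →⋆ₙₐ[ℂ] C) {S : Set C}
    (hS : Dense ((Submodule.span ℂ S : Submodule ℂ C) : Set C)) (l : Filter (C ≃⋆ₐ[ℂ] C))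
    (h : ∀ c ∈ S, Tendsto (fun σ : C ≃⋆ₐ[ℂ] C => Metric.infDist (σ c) (Set.range ι)) l (𝓝 0))
    (c : C) : Tendsto (fun σ : C ≃⋆ₐ[ℂ] C => Metric.infDist (σ c) (Set.range ι)) l (𝓝 0) := by
  have hne : (Set.range ι).Nonempty := ⟨_, 0, rfl⟩
  have key : ∀ c, Tendsto (fun σ : C ≃⋆ₐ[ℂ] C => Metric.infDist (σ c) (Set.range ι)) l (𝓝 0) ↔
      ∀ ε > 0, ∀ᶠ σ : C ≃⋆ₐ[ℂ] C in l, ∃ b, ‖σ c - ι b‖ < ε := fun c => by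
    rw [Metric.tendsto_nhds]
    refine forall₂_congr fun ε hε => eventually_congr (.of_forall fun σ => ?_)
    rw [Real.dist_0_eq_abs, abs_of_nonneg Metric.infDist_nonneg, Metric.infDist_lt_iff hne]
    simp [dist_eq_norm]
  simp only [key] at h ⊢
  refine forall_of_dense_span hS (fun c => ∀ ε > 0, ∀ᶠ σ : C ≃⋆ₐ[ℂ] C in l, ∃ b, ‖σ c - ι b‖ < ε)
    h ?_ ?_ ?_ ?_ c
  · exact fun ε hε => .of_forall fun σ => ⟨0, by simpa using hε⟩
  · intro x y hx hy ε hε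
    filter_upwards [hx (ε / 2) (half_pos hε), hy (ε / 2) (half_pos hε)] with σ ⟨b, hb⟩ ⟨b', hb'⟩
    refine ⟨b + b', ?_⟩
    rw [map_add, map_add, add_sub_add_comm]
    exact (norm_add_le _ _).trans_lt (by linarith)
  · intro t x hx ε hε
    filter_upwards [hx (ε / (‖t‖ + 1)) (by positivity)] with σ ⟨b, hb⟩
    refine ⟨t • b, ?_⟩
    rw [map_smul, map_smul, ← smul_sub, norm_smul]
    rw [lt_div_iff₀ (by positivity)] at hb
    nlinarith [norm_nonneg (σ x - ι b), norm_nonneg t]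
  · intro x hx ε hε
    obtain ⟨y, hy, hxy⟩ := hx (ε / 2) (half_pos hε)
    filter_upwards [hy (ε / 2) (half_pos hε)] with σ ⟨b, hb⟩
    refine ⟨b, ?_⟩
    have h1 : ‖σ x - σ y‖ = ‖x - y‖ := by rw [← map_sub, norm_starAlgEquiv_apply]
    have := norm_sub_le_norm_sub_add_norm_sub (σ x) (σ y) (ι b)
    linarith

end

/-- `D`-stability passes to hereditary subalgebras: if `D` is separable, unital, strongly
self-absorbing and `K₁`-injective, `A` is separable and `D`-stable (witnessed by an
isomorphism `A ⊗ D ≅ A`), and `B ⊆ A` is a hereditary C*-subalgebra (realized as the range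
of an injective *-homomorphism `β : B → A`), then `B` is `D`-stable. -/
theorem stmt_13 {A B D TD AD : Type u}
    [NonUnitalCStarAlgebra A] [NonUnitalCStarAlgebra B] [CStarAlgebra D]
    [CStarAlgebra TD] [NonUnitalCStarAlgebra AD]
    [TopologicalSpace.SeparableSpace A] [TopologicalSpace.SeparableSpace D]
    (hD : MinTensor D D TD) (hDu : hD.tmul 1 1 = 1)
    (hssa : IsStronglySelfAbsorbing hD) (hK1 : K1Injective D)
    -- `A` is `D`-stable
    (hAD : MinTensor A D AD) (hstable : Nonempty (AD ≃⋆ₐ[ℂ] A))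
    -- `B` is a hereditary subalgebra of `A`
    (β : B →⋆ₙₐ[ℂ] A) (hβ : Function.Injective β)
    (hher : ∀ a ∈ Set.range β, CStarNonneg a →
      ∀ b : A, CStarNonneg b → CStarNonneg (a - b) → b ∈ Set.range β) :
    -- then `B` is `D`-stable
    ∀ (BD : Type u) [NonUnitalCStarAlgebra BD],
      MinTensor B D BD → Nonempty (BD ≃⋆ₐ[ℂ] B) := by
  intro BD _ hBD
  obtain ⟨α⟩ := hstable
  obtain ⟨-, φ, hφ⟩ := hssa
  rcases subsingleton_or_nontrivial D with hDs | hDs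
  · have hBDs : Subsingleton BD := hBD.toCStarTensor.subsingleton
    have hADs : Subsingleton AD := hAD.toCStarTensor.subsingleton
    have hAs : Subsingleton A := α.symm.injective.subsingleton
    have hBs : Subsingleton B := hβ.subsingleton
    exact ⟨StarAlgEquiv.ofBijective (0 : BD →⋆ₙₐ[ℂ] B)
      ⟨Function.injective_of_subsingleton _, fun b => ⟨0, Subsingleton.elim _ _⟩⟩⟩
  have hβi : Isometry β := AddMonoidHomClass.isometry_of_norm β fun b =>
    NonUnitalStarAlgHom.norm_map β hβ b
  have : TopologicalSpace.SeparableSpace B :=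
    have := UniformSpace.secondCountable_of_separable A
    have := hβi.isUniformInducing.isInducing.secondCountableTopology
    inferInstance
  have : TopologicalSpace.SeparableSpace BD := hBD.separableSpace
  obtain ⟨l, hl, hlim⟩ := exists_filter_tendsto_zero
    (fun (p : B × D) (σ : BD ≃⋆ₐ[ℂ] BD) => max ‖σ (hBD.tmul p.1 1) - hBD.tmul p.1 1‖
      (Metric.infDist (σ (hBD.tmul p.1 p.2)) (Set.range hBD.inl)))
    (fun p σ => le_max_of_le_left (norm_nonneg _)) fun S ε hε => by
      obtain ⟨σ, hσ⟩ := hD.exists_approx_intertwiner hDu φ hφ.au hK1 hAD.toCStarTensor α β hβ hher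
        hBD S hε
      refine ⟨σ, fun p hp => max_lt (hσ p hp).1 ?_⟩
      obtain ⟨-, b, hb⟩ := hσ p hp
      rw [← dist_eq_norm] at hb
      exact (Metric.infDist_le_dist_of_mem (Set.mem_range_self b)).trans_lt hb
  refine nonempty_starAlgEquiv_of_intertwining hBD.inl hBD.norm_inl l (fun b => ?_)
    (tendsto_infDist_range_of_dense_span hBD.inl hBD.dense_span l ?_)
  · exact squeeze_zero (fun _ => norm_nonneg _) (fun σ => le_max_left _ _) (hlim (b, 1))
  · rintro _ ⟨b, d, rfl⟩
    exact squeeze_zero (fun _ => Metric.infDist_nonneg) (fun σ => le_max_right _ _) (hlim (b, d))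
end
end

section
/- Let 0 → J → E → A → 0 be a short exact sequence of separable C*-algebras with quotient map q : E → A. Then the induced *-homomorphism q̄ : Q(E) → Q(A) maps the relative commutant Q(E) ∩ E′ onto Q(A) ∩ A′. -/
open scoped MultiplierAlgebra TensorProduct
open Filter Topology

noncomputable section

universe u v w x

/-- The *-subalgebra `∏_ℕ A` of bounded sequences inside `ℕ → A`. -/
def boundedSeqs (A : Type u) [NonUnitalCStarAlgebra A] :
    NonUnitalStarSubalgebra ℂ (ℕ → A) where
  carrier := {f | ∃ C, ∀ n, ‖f n‖ ≤ C}
  add_mem' := by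
    rintro f g ⟨C, hC⟩ ⟨D, hD⟩
    exact ⟨C + D, fun n => (norm_add_le _ _).trans (add_le_add (hC n) (hD n))⟩
  zero_mem' := ⟨0, fun n => by simp⟩
  mul_mem' := by
    rintro f g ⟨C, hC⟩ ⟨D, hD⟩
    refine ⟨C * D, fun n => (norm_mul_le _ _).trans ?_⟩
    exact mul_le_mul (hC n) (hD n) (norm_nonneg _) ((norm_nonneg (f n)).trans (hC n))
  smul_mem' := by
    rintro c f ⟨C, hC⟩
    exact ⟨‖c‖ * C, fun n => by
      rw [Pi.smul_apply, norm_smul]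
      exact mul_le_mul_of_nonneg_left (hC n) (norm_nonneg c)⟩
  star_mem' := by
    rintro f ⟨C, hC⟩
    exact ⟨C, fun n => by simpa using hC n⟩

/-- The constant sequence, as a bounded sequence. -/
def constSeq {A : Type u} [NonUnitalCStarAlgebra A] (a : A) : boundedSeqs A :=
  ⟨fun _ => a, ⟨‖a‖, fun _ => le_rfl⟩⟩

/-- Data exhibiting `QA` as the sequence algebra `Q(A) = (∏_ℕ A) / (⊕_ℕ A)`: a surjective
*-homomorphism from the algebra of bounded sequences whose kernel is exactly the ideal of
sequences converging to zero in norm. -/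
structure IsSeqCorona (A : Type u) [NonUnitalCStarAlgebra A] (QA : Type v)
    [NonUnitalCStarAlgebra QA] where
  q : boundedSeqs A →⋆ₙₐ[ℂ] QA
  surjective : Function.Surjective q
  ker_iff : ∀ f : boundedSeqs A,
    q f = 0 ↔ Tendsto (fun n => ‖(f : ℕ → A) n‖) atTop (𝓝 (0 : ℝ))

/-- The canonical embedding `A → Q(A)` via constant sequences. -/
def IsSeqCorona.incl {A : Type u} [NonUnitalCStarAlgebra A] {QA : Type v}
    [NonUnitalCStarAlgebra QA] (h : IsSeqCorona A QA) : A → QA :=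
  fun a => h.q (constSeq a)

namespace SeqCorona

open scoped CStarAlgebra in
lemma continuous_starAlgHom {E A : Type*} [NonUnitalCStarAlgebra E] [NonUnitalCStarAlgebra A]
    (q : E →⋆ₙₐ[ℂ] A) : Continuous q :=
  map_continuous q

lemma norm_add_sq_le_of_star_mul {E : Type*} [NonUnitalCStarAlgebra E] (s x : E) :
    ‖s + x‖ ^ 2 ≤ ‖s‖ ^ 2 + 2 * ‖star s * x‖ + ‖x‖ ^ 2 := by
  have h1 : star (s + x) * (s + x)
      = star s * s + star s * x + star (star s * x) + star x * x := by
    rw [star_add, star_mul, star_star]; noncomm_ring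
  have h2 : ‖s + x‖ ^ 2 = ‖star (s + x) * (s + x)‖ := by
    rw [CStarRing.norm_star_mul_self, sq]
  have h3 : ‖star s * s‖ = ‖s‖ ^ 2 := by rw [CStarRing.norm_star_mul_self, sq]
  have h4 : ‖star x * x‖ = ‖x‖ ^ 2 := by rw [CStarRing.norm_star_mul_self, sq]
  have h5 : ‖star (star s * x)‖ = ‖star s * x‖ := norm_star _
  rw [h2, h1]
  refine (norm_add₄_le).trans ?_
  linarith

section Quasicentral

variable {E A : Type*} [NonUnitalCStarAlgebra E] [NonUnitalCStarAlgebra A]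

/-- Commutators with `d` of elements far out in an approximate unit of an ideal are almost
orthogonal, so the commutator of a sum of `m` of them has norm of order `√m`. -/
lemma exists_sum_norm_commutator_sq_le (q : E →⋆ₙₐ[ℂ] A) (l : Filter E) [l.NeBot]
    (hl_ker : ∀ᶠ j in l, q j = 0) (hl_norm : ∀ᶠ j in l, ‖j‖ ≤ 1)
    (hl_mul : ∀ z, q z = 0 → Tendsto (z * ·) l (𝓝 z))
    (D Z : Finset E) (hZ : ∀ z ∈ Z, q z = 0) {ε : ℝ} (hε : 0 < ε) (m : ℕ) :
    ∃ y : E, q y = 0 ∧ ‖y‖ ≤ m ∧ (∀ z ∈ Z, ‖(m : ℂ) • z - z * y‖ ≤ m * ε) ∧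
      ∀ d ∈ D, ‖y * d - d * y‖ ^ 2 ≤ m * (4 * ‖d‖ ^ 2 + 1) := by
  induction m with
  | zero => exact ⟨0, by simp⟩
  | succ m ih =>
    obtain ⟨y, hy, hy_norm, hy_Z, hy_D⟩ := ih
    have hl_Z : ∀ᶠ j in l, ∀ z ∈ Z, ‖z - z * j‖ ≤ ε := by
      refine (Filter.eventually_all_finset Z).2 fun z hz => ?_
      have := (tendsto_const_nhds (x := z)).sub (hl_mul z (hZ z hz))
      rw [sub_self] at this
      exact this.norm.eventually_le_const (by simpa using hε)
    have hl_D : ∀ᶠ j in l, ∀ d ∈ D,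
        ‖star (y * d - d * y) * (j * d - d * j)‖ ≤ 1 / 2 := by
      refine (Filter.eventually_all_finset D).2 fun d _ => ?_
      set s := star (y * d - d * y)
      have hs : q s = 0 := by simp [s, map_star, hy]
      have h1 := ((hl_mul s hs).mul_const d).sub (hl_mul (s * d) (by simp [hs]))
      rw [sub_self] at h1
      refine (h1.norm.eventually_le_const (u := 1 / 2) (by simp)).mono fun j hj => ?_
      rwa [mul_sub, ← mul_assoc, ← mul_assoc]
    obtain ⟨j, hj, hj_norm, hj_Z, hj_D⟩ :=
      (hl_ker.and (hl_norm.and (hl_Z.and hl_D))).exists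
    refine ⟨y + j, by simp [hy, hj], ?_, fun z hz => ?_, fun d hd => ?_⟩
    · push_cast
      exact (norm_add_le _ _).trans (add_le_add hy_norm hj_norm)
    · have h : ((m + 1 : ℕ) : ℂ) • z - z * (y + j) = ((m : ℂ) • z - z * y) + (z - z * j) := by
        push_cast
        rw [add_smul, one_smul, mul_add]
        abel
      rw [h]
      push_cast
      refine (norm_add_le _ _).trans ?_
      linarith [hy_Z z hz, hj_Z z hz]
    · have h : (y + j) * d - d * (y + j) = (y * d - d * y) + (j * d - d * j) := by
        rw [add_mul, mul_add]; abel
      have hj_comm : ‖j * d - d * j‖ ≤ 2 * ‖d‖ := by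
        have h1 := (norm_mul_le_of_le hj_norm (le_refl ‖d‖))
        have h2 := (norm_mul_le_of_le (le_refl ‖d‖) hj_norm)
        linarith [norm_sub_le (j * d) (d * j)]
      have hj_sq : ‖j * d - d * j‖ ^ 2 ≤ (2 * ‖d‖) ^ 2 := by gcongr
      rw [h]
      push_cast
      linarith [norm_add_sq_le_of_star_mul (y * d - d * y) (j * d - d * j), hy_D d hd, hj_D d hd]

/-- An approximate unit of the kernel of `q` can be averaged to a quasicentral one. -/
lemma exists_quasicentral (q : E →⋆ₙₐ[ℂ] A) (l : Filter E) [l.NeBot]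
    (hl_ker : ∀ᶠ j in l, q j = 0) (hl_norm : ∀ᶠ j in l, ‖j‖ ≤ 1)
    (hl_mul : ∀ z, q z = 0 → Tendsto (z * ·) l (𝓝 z))
    (D Z : Finset E) (hZ : ∀ z ∈ Z, q z = 0) {ε : ℝ} (hε : 0 < ε) :
    ∃ j : E, q j = 0 ∧ ‖j‖ ≤ 1 ∧ (∀ z ∈ Z, ‖z - z * j‖ ≤ ε) ∧
      ∀ d ∈ D, ‖j * d - d * j‖ ≤ ε := by
  obtain ⟨m, hm, hm_D⟩ : ∃ m : ℕ, 0 < m ∧ ∀ d ∈ D, 4 * ‖d‖ ^ 2 + 1 ≤ m * ε ^ 2 := by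
    have h : ∀ᶠ m : ℕ in atTop, ∀ d ∈ D, 4 * ‖d‖ ^ 2 + 1 ≤ m * ε ^ 2 :=
      (Filter.eventually_all_finset D).2 fun d _ =>
        (tendsto_natCast_atTop_atTop.atTop_mul_const (by positivity)).eventually_ge_atTop _
    exact ((eventually_gt_atTop 0).and h).exists
  obtain ⟨y, hy, hy_norm, hy_Z, hy_D⟩ :=
    exists_sum_norm_commutator_sq_le q l hl_ker hl_norm hl_mul D Z hZ hε m
  have hm' : (0 : ℝ) < m := by exact_mod_cast hm
  have hmc : (m : ℂ) ≠ 0 := by exact_mod_cast hm.ne'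
  have hnorm (x : E) : ‖(m : ℂ)⁻¹ • x‖ = ‖x‖ / m := by
    rw [norm_smul, norm_inv, Complex.norm_natCast, div_eq_inv_mul]
  refine ⟨(m : ℂ)⁻¹ • y, by simp [hy], ?_, fun z hz => ?_, fun d hd => ?_⟩
  · rw [hnorm]
    exact div_le_one_of_le₀ hy_norm hm'.le
  · have h : z - z * ((m : ℂ)⁻¹ • y) = (m : ℂ)⁻¹ • ((m : ℂ) • z - z * y) := by
      rw [smul_sub, smul_smul, inv_mul_cancel₀ hmc, one_smul, mul_smul_comm]
    rw [h, hnorm, div_le_iff₀ hm', mul_comm ε]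
    exact hy_Z z hz
  · rw [smul_mul_assoc, mul_smul_comm, ← smul_sub, hnorm, div_le_iff₀ hm']
    refine le_of_sq_le_sq ?_ (by positivity)
    calc _ ≤ m * (4 * ‖d‖ ^ 2 + 1) := hy_D d hd
      _ ≤ m * (m * ε ^ 2) := by gcongr; exact hm_D d hd
      _ = (ε * m) ^ 2 := by ring

end Quasicentral

/-- The image of `J` in an extension carries an approximate unit of contractions. -/
lemma exists_approximateUnit_ker {J E A : Type*} [NonUnitalCStarAlgebra J]
    [NonUnitalCStarAlgebra E] [NonUnitalCStarAlgebra A] (ι : J →⋆ₙₐ[ℂ] E) (q : E →⋆ₙₐ[ℂ] A)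
    (hker : ∀ e : E, q e = 0 ↔ e ∈ Set.range ι) :
    ∃ l : Filter E, l.NeBot ∧ (∀ᶠ j in l, q j = 0) ∧ (∀ᶠ j in l, ‖j‖ ≤ 1) ∧
      ∀ z, q z = 0 → Tendsto (z * ·) l (𝓝 z) := by
  let _ := CStarAlgebra.spectralOrder J
  have := CStarAlgebra.spectralOrderedRing J
  have hJ := CStarAlgebra.increasingApproximateUnit J
  refine ⟨(CStarAlgebra.approximateUnit J).map ι, inferInstance, ?_, ?_, fun z hz => ?_⟩
  · exact Filter.eventually_map.2 (.of_forall fun j => (hker _).2 ⟨j, rfl⟩)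
  · exact Filter.eventually_map.2 (hJ.eventually_norm.mono fun j hj =>
      (NonUnitalStarAlgHom.norm_apply_le ι j).trans hj)
  · obtain ⟨t, rfl⟩ := (hker z).1 hz
    have hι : Continuous ι := continuous_starAlgHom ι
    refine Filter.tendsto_map'_iff.2 ?_
    simpa [Function.comp_def] using (hι.tendsto t).comp (hJ.tendsto_mul_left t)

/-- A class in the sequence algebra commutes with a constant iff the commutators of a
representing sequence tend to zero. -/
lemma commute_incl_iff {A QA : Type*} [NonUnitalCStarAlgebra A] [NonUnitalCStarAlgebra QA]
    (h : IsSeqCorona A QA) (f : boundedSeqs A) (a : A) :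
    h.q f * h.incl a = h.incl a * h.q f ↔
      Tendsto (fun n => ‖(f : ℕ → A) n * a - a * (f : ℕ → A) n‖) atTop (𝓝 0) := by
  rw [IsSeqCorona.incl, ← sub_eq_zero, ← map_mul, ← map_mul, ← map_sub, h.ker_iff]
  rfl

/-- Asymptotic commutation with a dense sequence extends to the whole algebra. -/
lemma tendsto_commutator_of_denseRange {E : Type*} [NonUnitalCStarAlgebra E] {x : ℕ → E}
    {M : ℝ} (hx : ∀ n, ‖x n‖ ≤ M) {d : ℕ → E} (hd : DenseRange d)
    (h : ∀ k, Tendsto (fun n => ‖x n * d k - d k * x n‖) atTop (𝓝 0)) (e : E) :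
    Tendsto (fun n => ‖x n * e - e * x n‖) atTop (𝓝 0) := by
  have hM : 0 ≤ M := (norm_nonneg _).trans (hx 0)
  rw [Metric.tendsto_atTop]
  intro ε hε
  obtain ⟨k, hk⟩ := hd.exists_dist_lt e (ε := ε / (2 * (2 * M + 1))) (by positivity)
  obtain ⟨N, hN⟩ := Metric.tendsto_atTop.1 (h k) (ε / 2) (by positivity)
  refine ⟨N, fun n hn => ?_⟩
  have h1 := hN n hn
  rw [Real.dist_0_eq_abs, abs_norm] at h1 ⊢
  rw [dist_eq_norm, lt_div_iff₀ (by positivity)] at hk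
  have h2 : x n * e - e * x n
      = (x n * d k - d k * x n) + (x n * (e - d k) - (e - d k) * x n) := by
    noncomm_ring
  have h3 : ‖x n * (e - d k)‖ ≤ M * ‖e - d k‖ := norm_mul_le_of_le (hx n) le_rfl
  have h4 : ‖(e - d k) * x n‖ ≤ ‖e - d k‖ * M := norm_mul_le_of_le le_rfl (hx n)
  rw [h2]
  have h5 := norm_add_le (x n * d k - d k * x n) (x n * (e - d k) - (e - d k) * x n)
  have h6 := norm_sub_le (x n * (e - d k)) ((e - d k) * x n)
  nlinarith [norm_nonneg (e - d k)]

/-- A bounded sequence of `E` that asymptotically commutes modulo the kernel of `q` can be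
corrected inside the kernel to one that asymptotically commutes. -/
lemma exists_asymptotically_central_lift {J E A : Type*} [NonUnitalCStarAlgebra J]
    [NonUnitalCStarAlgebra E] [NonUnitalCStarAlgebra A] [TopologicalSpace.SeparableSpace E]
    (ι : J →⋆ₙₐ[ℂ] E) (q : E →⋆ₙₐ[ℂ] A) (hker : ∀ e : E, q e = 0 ↔ e ∈ Set.range ι)
    {C : ℝ} (hC : ∀ a, ∃ e, q e = a ∧ ‖e‖ ≤ C * ‖a‖) {f : ℕ → E} {M : ℝ}
    (hf : ∀ n, ‖f n‖ ≤ M)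
    (hcomm : ∀ e, Tendsto (fun n => ‖q (f n) * q e - q e * q (f n)‖) atTop (𝓝 0)) :
    ∃ x : ℕ → E, (∀ n, ‖x n‖ ≤ 2 * M) ∧ (∀ n, q (x n) = q (f n)) ∧
      ∀ e, Tendsto (fun n => ‖x n * e - e * x n‖) atTop (𝓝 0) := by
  classical
  obtain ⟨l, hl, hl_ker, hl_norm, hl_mul⟩ := exists_approximateUnit_ker ι q hker
  have hM : 0 ≤ M := (norm_nonneg _).trans (hf 0)
  choose σ hσ hσ_norm using hC
  let d : ℕ → E := TopologicalSpace.denseSeq E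
  let c (n k : ℕ) : E := f n * d k - d k * f n
  let z (n k : ℕ) : E := c n k - σ (q (c n k))
  have hz (n k : ℕ) : q (z n k) = 0 := by simp [z, hσ]
  choose j hj hj_norm hj_Z hj_D using fun n : ℕ =>
    exists_quasicentral q l hl_ker hl_norm hl_mul ((Finset.range n).image d)
      ((Finset.range n).image (z n)) (by simp [hz]) (Nat.one_div_pos_of_nat (α := ℝ) (n := n))
  have hx_norm (n : ℕ) : ‖f n - f n * j n‖ ≤ 2 * M := by
    have h1 : ‖f n * j n‖ ≤ M * 1 := norm_mul_le_of_le (hf n) (hj_norm n)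
    linarith [norm_sub_le (f n) (f n * j n), hf n]
  refine ⟨fun n => f n - f n * j n, hx_norm, fun n => by simp [hj],
    tendsto_commutator_of_denseRange hx_norm (TopologicalSpace.denseRange_denseSeq E) fun k => ?_⟩
  have hbound : ∀ᶠ n in atTop, ‖(f n - f n * j n) * d k - d k * (f n - f n * j n)‖ ≤
      2 * C * ‖q (f n) * q (d k) - q (d k) * q (f n)‖ + (1 + M) * (1 / ((n : ℝ) + 1)) := by
    filter_upwards [eventually_gt_atTop k] with n hn
    have h1 := hj_Z n (z n k) (Finset.mem_image_of_mem _ (Finset.mem_range.2 hn))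
    have h2 := hj_D n (d k) (Finset.mem_image_of_mem _ (Finset.mem_range.2 hn))
    have h3 := hσ_norm (q (c n k))
    have h4 : q (c n k) = q (f n) * q (d k) - q (d k) * q (f n) := by simp [c]
    rw [← h4]
    have h5 : (f n - f n * j n) * d k - d k * (f n - f n * j n) =
        (σ (q (c n k)) - σ (q (c n k)) * j n) + (z n k - z n k * j n)
          - f n * (j n * d k - d k * j n) := by
      simp only [z, c]; noncomm_ring
    have h6 : ‖σ (q (c n k)) * j n‖ ≤ ‖σ (q (c n k))‖ * 1 :=
      norm_mul_le_of_le le_rfl (hj_norm n)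
    have h7 : ‖f n * (j n * d k - d k * j n)‖ ≤ M * (1 / ((n : ℝ) + 1)) :=
      norm_mul_le_of_le (hf n) h2
    rw [h5]
    have h8 := norm_sub_le ((σ (q (c n k)) - σ (q (c n k)) * j n) + (z n k - z n k * j n))
      (f n * (j n * d k - d k * j n))
    have h9 := norm_add_le (σ (q (c n k)) - σ (q (c n k)) * j n) (z n k - z n k * j n)
    have h10 := norm_sub_le (σ (q (c n k))) (σ (q (c n k)) * j n)
    linarith
  refine squeeze_zero' (.of_forall fun n => norm_nonneg _) hbound ?_
  simpa using ((hcomm (d k)).const_mul (2 * C)).add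
    (tendsto_one_div_add_atTop_nhds_zero_nat.const_mul (1 + M))

end SeqCorona

/-- Given a short exact sequence `0 → J → E → A → 0` of separable C*-algebras, the induced
*-homomorphism `q̄ : Q(E) → Q(A)` between the sequence algebras maps the relative
commutant `Q(E) ∩ E′` onto `Q(A) ∩ A′`. -/
theorem stmt_16 {J E A : Type u} {QE QA : Type v}
    [NonUnitalCStarAlgebra J] [NonUnitalCStarAlgebra E] [NonUnitalCStarAlgebra A]
    [NonUnitalCStarAlgebra QE] [NonUnitalCStarAlgebra QA]
    [TopologicalSpace.SeparableSpace J] [TopologicalSpace.SeparableSpace E]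
    [TopologicalSpace.SeparableSpace A]
    -- the short exact sequence `0 → J → E → A → 0`
    (ι : J →⋆ₙₐ[ℂ] E) (hι : Function.Injective ι)
    (q : E →⋆ₙₐ[ℂ] A) (hq : Function.Surjective q)
    (hker : ∀ e : E, q e = 0 ↔ e ∈ Set.range ι)
    -- realizations of `Q(E)` and `Q(A)`
    (hQE : IsSeqCorona E QE) (hQA : IsSeqCorona A QA)
    -- the induced map `q̄ : Q(E) → Q(A)`
    (qbar : QE →⋆ₙₐ[ℂ] QA)
    (hqbar : ∀ (f : ℕ → E) (hf : f ∈ boundedSeqs E)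
      (hg : (fun n => q (f n)) ∈ boundedSeqs A),
      qbar (hQE.q ⟨f, hf⟩) = hQA.q ⟨fun n => q (f n), hg⟩) :
    -- `q̄` maps `Q(E) ∩ E′` onto `Q(A) ∩ A′`
    qbar '' {x : QE | ∀ e : E, x * hQE.incl e = hQE.incl e * x} =
      {y : QA | ∀ a : A, y * hQA.incl a = hQA.incl a * y} := by
  have hmem {f : ℕ → E} (hf : f ∈ boundedSeqs E) : (fun n => q (f n)) ∈ boundedSeqs A := by
    obtain ⟨C, hC⟩ := hf
    exact ⟨C, fun n => (NonUnitalStarAlgHom.norm_apply_le q _).trans (hC n)⟩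
  have hincl (e : E) : qbar (hQE.incl e) = hQA.incl (q e) :=
    hqbar _ (constSeq e).2 (constSeq (q e)).2
  ext y
  constructor
  · rintro ⟨x, hx, rfl⟩ a
    obtain ⟨e, rfl⟩ := hq a
    rw [← hincl, ← map_mul, ← map_mul, hx e]
  · intro hy
    obtain ⟨⟨a, M, hM⟩, rfl⟩ := hQA.surjective y
    let qL : E →L[ℂ] A := ⟨(q : E →ₗ[ℂ] A), SeqCorona.continuous_starAlgHom q⟩
    obtain ⟨C, hC0, hC⟩ := qL.exists_preimage_norm_le hq
    choose f hf hf_norm using fun n => hC (a n)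
    obtain ⟨x, hx, hqx, hx_comm⟩ := SeqCorona.exists_asymptotically_central_lift ι q hker hC
      (f := f) (M := C * M) (fun n => (hf_norm n).trans (by gcongr; exact hM n)) (fun e => by
        have := (SeqCorona.commute_incl_iff hQA _ (q e)).1 (hy (q e))
        have hf' : ∀ n, q (f n) = a n := hf
        simpa only [hf'] using this)
    have hxb : x ∈ boundedSeqs E := ⟨_, hx⟩
    refine ⟨hQE.q ⟨x, hxb⟩, fun e => (SeqCorona.commute_incl_iff hQE _ e).2 (hx_comm e), ?_⟩
    rw [hqbar x hxb (hmem hxb)]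
    congr 2
    funext n
    exact (hqx n).trans (hf n)
end
end
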